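/- arXiv:1111.4851 — 2 statements merged into one kernel-verified Lean document; each statement's English description precedes it below -/
import Mathlib

section
/- Let N ≥ 1 and s ≥ 1. Then there exists a constant C > 0 such that for all f, g ∈ S(ℝ^N): ‖Λ^s(fg) − f Λ^s g‖_{L²} ≤ C(‖∇f‖_{L^∞} ‖Λ^{s−1} g‖_{L²} + ‖g‖_{L^∞} ‖Λ^s f‖_{L²}). -/
open MeasureTheory Filter Topology SchwartzMap
open scoped ENNReal FourierTransform

/-- `Λ^s f = F⁻¹(|ξ|^s F f)`, the Fourier-multiplier definition of the fractional operator. -/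
noncomputable def LamF (N : ℕ) (s : ℝ) (f : EuclideanSpace ℝ (Fin N) → ℝ)
    (x : EuclideanSpace ℝ (Fin N)) : ℝ :=
  (𝓕⁻ (fun ξ : EuclideanSpace ℝ (Fin N) =>
    ((‖ξ‖ ^ s : ℝ) : ℂ) * 𝓕 (fun y => (f y : ℂ)) ξ) x).re

namespace KatoPonce

section Schwartz

variable {V : Type*} [NormedAddCommGroup V] [InnerProductSpace ℝ V]

/-- The pointwise product of Schwartz functions. -/
noncomputable def sprod (f g : 𝓢(V, ℂ)) : 𝓢(V, ℂ) := pairing (ContinuousLinearMap.mul ℂ ℂ) f g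

@[simp] lemma sprod_apply (f g : 𝓢(V, ℂ)) (x : V) : sprod f g x = f x * g x := by
  simp [sprod, pairing_apply_apply]

lemma hasTemperateGrowth_comp_smul (m : 𝓢(V, ℂ)) (r : ℝ) :
    Function.HasTemperateGrowth (fun ξ => m (r • ξ)) :=
  m.hasTemperateGrowth.comp (r • ContinuousLinearMap.id ℝ V).hasTemperateGrowth

variable [MeasurableSpace V] [BorelSpace V] [FiniteDimensional ℝ V]

/-- The squared `L²` norm of a function, as an extended nonnegative real. -/
noncomputable def energy (u : V → ℂ) : ℝ≥0∞ := ∫⁻ x, ‖u x‖ₑ ^ 2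

lemma energy_eq_eLpNorm_sq (u : V → ℂ) : energy u = eLpNorm u 2 volume ^ 2 := by
  rw [eLpNorm_eq_lintegral_rpow_enorm_toReal (by norm_num) (by norm_num), energy,
    ← ENNReal.rpow_natCast, ← ENNReal.rpow_mul]
  simp

/-- The Fourier transform on complex valued Schwartz functions. -/
noncomputable def ft : 𝓢(V, ℂ) ≃L[ℂ] 𝓢(V, ℂ) := FourierTransform.fourierCLE ℂ 𝓢(V, ℂ)

lemma ft_coe (f : 𝓢(V, ℂ)) : (ft f : V → ℂ) = 𝓕 (f : V → ℂ) := rfl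

lemma ft_symm_coe (f : 𝓢(V, ℂ)) : (ft.symm f : V → ℂ) = 𝓕⁻ (f : V → ℂ) := fourierInv_coe f

lemma energy_ft (f : 𝓢(V, ℂ)) : energy (V := V) (ft f) = energy (V := V) f := by
  rw [energy_eq_eLpNorm_sq, energy_eq_eLpNorm_sq]
  have h : ‖(ft f).toLp 2‖ = ‖f.toLp 2‖ := norm_fourier_toL2_eq f
  rw [norm_toLp, norm_toLp, ENNReal.toReal_eq_toReal_iff' ((ft f).eLpNorm_lt_top 2 volume).ne
    (f.eLpNorm_lt_top 2 volume).ne] at h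
  rw [h]

lemma ft_sprod_apply (f g : 𝓢(V, ℂ)) (ξ : V) :
    ft (sprod f g) ξ = ∫ η, ft f η * ft g (ξ - η) := by
  set B := ContinuousLinearMap.mul ℂ ℂ
  have h2 : SchwartzMap.convolution B (ft f) (ft g) = ft (sprod f g) := by
    have h3 : ft.symm (SchwartzMap.convolution B (ft f) (ft g)) = sprod f g := by
      ext x
      have := congrArg (fun u : 𝓢(V, ℂ) => u (-x)) (fourier_convolution B (ft f) (ft g))
      simp only [pairing_apply_apply, fourier_coe] at this
      rw [← Real.fourierInv_eq_fourier_neg, ← Real.fourierInv_eq_fourier_neg,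
        ← Real.fourierInv_eq_fourier_neg, ← ft_symm_coe, ← ft_symm_coe, ← ft_symm_coe] at this
      simpa [B] using this
    rw [← h3, ContinuousLinearEquiv.apply_symm_apply]
  rw [← h2, convolution_apply B (ft f) (ft g) ξ]
  rfl

lemma ft_sprod_eq_zero {f g : 𝓢(V, ℂ)} {ξ : V}
    (h : ∀ η, ft f η = 0 ∨ ft g (ξ - η) = 0) : ft (sprod f g) ξ = 0 := by
  rw [ft_sprod_apply]
  refine integral_eq_zero_of_ae (Eventually.of_forall fun η => ?_)
  rcases h η with h | h <;> simp [h]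

/-- The Fourier multiplier operator with symbol `ξ ↦ m (r ξ)`. -/
noncomputable def dil (m : 𝓢(V, ℂ)) (r : ℝ) : 𝓢(V, ℂ) →L[ℂ] 𝓢(V, ℂ) :=
  fourierMultiplierCLM ℂ (fun ξ => m (r • ξ))

lemma ft_dil_apply (m : 𝓢(V, ℂ)) (r : ℝ) (f : 𝓢(V, ℂ)) (ξ : V) :
    ft (dil m r f) ξ = m (r • ξ) * ft f ξ := by
  have : dil m r f = ft.symm (smulLeftCLM ℂ (fun ξ => m (r • ξ)) (ft f)) := rfl
  rw [this, ContinuousLinearEquiv.apply_symm_apply,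
    smulLeftCLM_apply_apply (hasTemperateGrowth_comp_smul m r), smul_eq_mul]

lemma eq_of_ft_eq {f g : 𝓢(V, ℂ)} (h : ∀ ξ, ft f ξ = ft g ξ) : f = g :=
  ft.injective (SchwartzMap.ext h)

lemma eq_integral_ft (f : 𝓢(V, ℂ)) (x : V) :
    f x = ∫ ξ, Real.fourierChar (inner ℝ ξ x) • ft f ξ := by
  conv_lhs => rw [← ft.symm_apply_apply f, ft_symm_coe, Real.fourierInv_eq]

lemma dil_apply (m : 𝓢(V, ℂ)) (r : ℝ) (f : 𝓢(V, ℂ)) (x : V) :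
    dil m r f x = ∫ y, ft.symm m y * f (x - r • y) := by
  have hm : ∀ z, m z = ∫ y, Real.fourierChar (-inner ℝ y z) • ft.symm m y := fun z => by
    conv_lhs => rw [← ft.apply_symm_apply m, ft_coe, Real.fourier_eq]
  have hInt : Integrable (fun ξ => Real.fourierChar (inner ℝ ξ x) • ft f ξ) := by
    have := (Real.fourierIntegral_convergent_iff (μ := volume) (f := ft f) (-x)).2
      (ft f).integrable
    simpa using this
  have key := VectorFourier.integral_fourierIntegral_smul_eq_flip (μ := volume) (ν := volume)
    (e := Real.fourierChar) (L := r • innerₗ V) (f := ft.symm m)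
    (g := fun ξ => Real.fourierChar (inner ℝ ξ x) • ft f ξ) Real.continuous_fourierChar
    (by simp; fun_prop) (ft.symm m).integrable hInt
  rw [eq_integral_ft]
  refine (integral_congr_ae (Eventually.of_forall fun ξ => ?_)).trans
    (key.trans (integral_congr_ae (Eventually.of_forall fun y => ?_)))
  · simp only [ft_dil_apply, hm, VectorFourier.fourierIntegral, Circle.smul_def, smul_eq_mul,
      LinearMap.smul_apply, innerₗ_apply_apply, inner_smul_right, ← mul_assoc]
    ring_nf
  · simp only [VectorFourier.fourierIntegral, smul_eq_mul]
    rw [eq_integral_ft f]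
    refine congrArg (ft.symm m y * ·) ?_
    refine integral_congr_ae (Eventually.of_forall fun ξ => ?_)
    simp only [Circle.smul_def, smul_smul, ← Circle.coe_mul, ← AddChar.map_add_eq_mul]
    congr 4
    simp only [LinearMap.flip_apply, LinearMap.smul_apply, innerₗ_apply_apply, inner_sub_right,
      inner_smul_right, real_inner_comm, smul_eq_mul]
    ring

end Schwartz

section Kernel

variable {V : Type*} [NormedAddCommGroup V] [InnerProductSpace ℝ V]
  [MeasurableSpace V] [BorelSpace V] [FiniteDimensional ℝ V]

/-- The moment of order `i` of the convolution kernel of the multiplier with symbol `m`. -/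
noncomputable def kmom (m : 𝓢(V, ℂ)) (i : ℕ) : ℝ≥0∞ := ∫⁻ y, ‖ft.symm m y‖ₑ * ‖y‖ₑ ^ i

lemma kmom_ne_top (m : 𝓢(V, ℂ)) (i : ℕ) : kmom m i ≠ ∞ := by
  have h := ((ft.symm m).integrable_pow_mul volume i).2
  rw [hasFiniteIntegral_iff_enorm] at h
  refine (lt_of_eq_of_lt ?_ h).ne
  refine lintegral_congr fun y => ?_
  rw [enorm_mul, enorm_pow, enorm_norm, enorm_norm, mul_comm]

lemma lintegral_kernel_mul (m : 𝓢(V, ℂ)) (i : ℕ) (c : ℝ≥0∞) :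
    ∫⁻ y, ‖ft.symm m y‖ₑ * ‖y‖ₑ ^ i * c = kmom m i * c := by
  rw [kmom, lintegral_mul_const]
  exact (ft.symm m).continuous.measurable.enorm.mul (measurable_id.enorm.pow_const i)

lemma integrable_kernel_mul (K f : 𝓢(V, ℂ)) (r : ℝ) (x : V) :
    Integrable fun y => K y * f (x - r • y) := by
  obtain ⟨C, hC⟩ : ∃ C, ∀ x, ‖f x‖ ≤ C := ⟨_, fun x => f.norm_le_seminorm ℝ x⟩
  exact K.integrable.mul_bdd (c := C) (f.continuous.comp (by fun_prop)).aestronglyMeasurable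
    (Eventually.of_forall fun y => hC _)

lemma enorm_dil_le {m f : 𝓢(V, ℂ)} {r : ℝ} {G : ℝ≥0∞} (hf : ∀ x, ‖f x‖ₑ ≤ G) (x : V) :
    ‖dil m r f x‖ₑ ≤ kmom m 0 * G := by
  rw [dil_apply]
  calc _ ≤ ∫⁻ y, ‖ft.symm m y * f (x - r • y)‖ₑ := enorm_integral_le_lintegral_enorm _
    _ ≤ ∫⁻ y, ‖ft.symm m y‖ₑ * ‖y‖ₑ ^ 0 * G := lintegral_mono fun y => by
        rw [enorm_mul, pow_zero, mul_one]; gcongr; exact hf _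
    _ = _ := lintegral_kernel_mul m 0 G

/-- The function `f` is Lipschitz with constant `A`. -/
def Lip (A : ℝ≥0∞) (f : V → ℂ) : Prop := ∀ x y, ‖f x - f y‖ₑ ≤ A * ‖x - y‖ₑ

lemma lip_dil {m f : 𝓢(V, ℂ)} {r : ℝ} {A : ℝ≥0∞} (hf : Lip A f) :
    Lip (kmom m 0 * A) (dil m r f) := by
  intro x x'
  rw [dil_apply, dil_apply, ← integral_sub (integrable_kernel_mul _ _ _ _)
    (integrable_kernel_mul _ _ _ _)]
  calc _ ≤ ∫⁻ y, ‖ft.symm m y * f (x - r • y) - ft.symm m y * f (x' - r • y)‖ₑ :=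
        enorm_integral_le_lintegral_enorm _
    _ ≤ ∫⁻ y, ‖ft.symm m y‖ₑ * ‖y‖ₑ ^ 0 * (A * ‖x - x'‖ₑ) := lintegral_mono fun y => by
        rw [← mul_sub, enorm_mul, pow_zero, mul_one]
        gcongr
        simpa using hf (x - r • y) (x' - r • y)
    _ = _ := by
        rw [lintegral_kernel_mul, mul_assoc]

lemma integral_kernel (m : 𝓢(V, ℂ)) : ∫ y, ft.symm m y = m 0 := by
  conv_rhs => rw [← ft.apply_symm_apply m, ft_coe, Real.fourier_eq]
  simp

lemma enorm_dil_le_of_lip {m f : 𝓢(V, ℂ)} {r : ℝ} {A : ℝ≥0∞} (hm : m 0 = 0) (hf : Lip A f)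
    (x : V) : ‖dil m r f x‖ₑ ≤ kmom m 1 * (‖r‖ₑ * A) := by
  have h : dil m r f x = ∫ y, ft.symm m y * (f (x - r • y) - f x) := by
    simp_rw [mul_sub]
    rw [integral_sub (integrable_kernel_mul _ _ _ _) ((ft.symm m).integrable.mul_const _),
      integral_mul_const, integral_kernel, hm, dil_apply, zero_mul, sub_zero]
  rw [h]
  calc _ ≤ ∫⁻ y, ‖ft.symm m y * (f (x - r • y) - f x)‖ₑ := enorm_integral_le_lintegral_enorm _
    _ ≤ ∫⁻ y, ‖ft.symm m y‖ₑ * ‖y‖ₑ ^ 1 * (‖r‖ₑ * A) := lintegral_mono fun y => by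
        rw [enorm_mul, pow_one, mul_assoc]
        gcongr
        refine (hf _ _).trans_eq ?_
        rw [sub_sub_cancel_left, enorm_neg, enorm_smul]
        ring
    _ = _ := lintegral_kernel_mul m 1 _

lemma energy_le_of_enorm_le_mul {u v : V → ℂ} {c : ℝ≥0∞} (hc : c ≠ ∞)
    (h : ∀ x, ‖u x‖ₑ ≤ c * ‖v x‖ₑ) : energy u ≤ c ^ 2 * energy v := by
  rw [energy, energy, ← lintegral_const_mul' _ _ (ENNReal.pow_ne_top hc)]
  exact lintegral_mono fun x => by rw [← mul_pow]; gcongr; exact h x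

lemma energy_const_mul (c : ℂ) (u : V → ℂ) :
    energy (fun x => c * u x) = ‖c‖ₑ ^ 2 * energy u := by
  rw [energy, energy, ← lintegral_const_mul' _ _ (by finiteness)]
  exact lintegral_congr fun x => by rw [enorm_mul, mul_pow]

lemma energy_dil_le {m : 𝓢(V, ℂ)} {r : ℝ} {c : ℝ≥0∞} (hc : c ≠ ∞) (hm : ∀ ξ, ‖m ξ‖ₑ ≤ c)
    (f : 𝓢(V, ℂ)) : energy (V := V) (dil m r f) ≤ c ^ 2 * energy (V := V) f := by
  rw [← energy_ft, ← energy_ft f]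
  refine energy_le_of_enorm_le_mul hc fun ξ => ?_
  rw [ft_dil_apply, enorm_mul]
  gcongr
  exact hm _

lemma energy_shift (f : 𝓢(V, ℂ)) (z : V) :
    ∫⁻ x, ‖f (x - z)‖ₑ ^ 2 = energy (V := V) f :=
  lintegral_sub_right_eq_self (fun x => ‖f x‖ₑ ^ 2) z

/-- Square function bound for the commutator of a multiplier with a multiplication operator. -/
lemma energy_commutator_le (m a h : 𝓢(V, ℂ)) (r : ℝ) {E : ℝ≥0∞}
    (hE : ∀ y, ∫⁻ x, ‖a (x - r • y) - a x‖ₑ ^ 2 * ‖h (x - r • y)‖ₑ ^ 2 ≤ ‖y‖ₑ ^ 2 * E) :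
    energy ⇑(dil m r (sprod a h) - sprod a (dil m r h)) ≤ kmom m 0 * kmom m 2 * E := by
  set K := ft.symm m with hK
  have hKm : Measurable fun y => ‖K y‖ₑ := K.continuous.measurable.enorm
  have hac := a.continuous
  have hhc := h.continuous
  have h1 : ∀ x, ‖(dil m r (sprod a h) - sprod a (dil m r h)) x‖ₑ ≤
      ∫⁻ y, ‖K y‖ₑ * (‖a (x - r • y) - a x‖ₑ * ‖h (x - r • y)‖ₑ) := by
    intro x
    have : (dil m r (sprod a h) - sprod a (dil m r h)) x =
        ∫ y, K y * ((a (x - r • y) - a x) * h (x - r • y)) := by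
      rw [sub_apply, sprod_apply, dil_apply, dil_apply, ← integral_const_mul, ← integral_sub
        (integrable_kernel_mul _ _ _ _) ((integrable_kernel_mul _ _ _ _).const_mul _)]
      refine integral_congr_ae (Eventually.of_forall fun y => ?_)
      simp only [sprod_apply, hK]
      ring
    rw [this]
    refine (enorm_integral_le_lintegral_enorm _).trans_eq (lintegral_congr fun y => ?_)
    rw [enorm_mul, enorm_mul]
  have h2 : ∀ x, ‖(dil m r (sprod a h) - sprod a (dil m r h)) x‖ₑ ^ 2 ≤
      kmom m 0 * ∫⁻ y, ‖K y‖ₑ * (‖a (x - r • y) - a x‖ₑ ^ 2 * ‖h (x - r • y)‖ₑ ^ 2) := by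
    intro x
    set w : V → ℝ≥0∞ := fun y => ‖a (x - r • y) - a x‖ₑ * ‖h (x - r • y)‖ₑ with hw
    have hwm : Measurable w := by
      exact Measurable.mul (Continuous.measurable (by fun_prop)).enorm
        (Continuous.measurable (by fun_prop)).enorm
    have hs : ∀ t : ℝ≥0∞, (t ^ (1 / 2 : ℝ)) ^ (2 : ℝ) = t := fun t => by
      rw [← ENNReal.rpow_mul]; simp
    have cs := ENNReal.lintegral_mul_le_Lp_mul_Lq volume Real.HolderConjugate.two_two
      (f := fun y => ‖K y‖ₑ ^ (1 / 2 : ℝ)) (g := fun y => ‖K y‖ₑ ^ (1 / 2 : ℝ) * w y)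
      (hKm.pow_const _).aemeasurable ((hKm.pow_const _).mul hwm).aemeasurable
    have e1 : ∀ y, ((fun y => ‖K y‖ₑ ^ (1 / 2 : ℝ)) * fun y => ‖K y‖ₑ ^ (1 / 2 : ℝ) * w y) y =
        ‖K y‖ₑ * w y := fun y => by
      simp only [Pi.mul_apply]
      rw [← mul_assoc, ← ENNReal.rpow_add_of_nonneg _ _ (by norm_num) (by norm_num)]
      norm_num
    simp only [hs, ENNReal.mul_rpow_of_nonneg _ _ (zero_le_two), lintegral_congr e1] at cs
    calc _ ≤ (∫⁻ y, ‖K y‖ₑ * w y) ^ 2 := by gcongr; exact h1 x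
      _ ≤ ((∫⁻ y, ‖K y‖ₑ) ^ (1 / 2 : ℝ) *
            (∫⁻ y, ‖K y‖ₑ * w y ^ (2 : ℝ)) ^ (1 / 2 : ℝ)) ^ 2 := by gcongr
      _ = (∫⁻ y, ‖K y‖ₑ) * ∫⁻ y, ‖K y‖ₑ * w y ^ (2 : ℝ) := by
          rw [← ENNReal.rpow_two, ENNReal.mul_rpow_of_nonneg _ _ (zero_le_two), hs, hs]
      _ = _ := by
          simp only [kmom, pow_zero, mul_one, ENNReal.rpow_two, hw, mul_pow, hK]
  calc energy ⇑(dil m r (sprod a h) - sprod a (dil m r h))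
      ≤ ∫⁻ x, kmom m 0 *
        ∫⁻ y, ‖K y‖ₑ * (‖a (x - r • y) - a x‖ₑ ^ 2 * ‖h (x - r • y)‖ₑ ^ 2) := lintegral_mono h2
    _ = kmom m 0 * ∫⁻ y, ∫⁻ x,
        ‖K y‖ₑ * (‖a (x - r • y) - a x‖ₑ ^ 2 * ‖h (x - r • y)‖ₑ ^ 2) := by
        rw [lintegral_const_mul' _ _ (kmom_ne_top m 0), lintegral_lintegral_swap]
        have hKc := K.continuous
        refine Measurable.aemeasurable ?_
        simp only [Function.uncurry_def]
        exact Measurable.mul (Continuous.measurable (by fun_prop)).enorm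
          (((Continuous.measurable (by fun_prop)).enorm.pow_const 2).mul
            ((Continuous.measurable (by fun_prop)).enorm.pow_const 2))
    _ ≤ kmom m 0 * ∫⁻ y, ‖K y‖ₑ * ‖y‖ₑ ^ 2 * E := by
        gcongr with y
        rw [lintegral_const_mul' _ _ (by finiteness), mul_assoc]
        gcongr
        exact hE y
    _ = _ := by
        rw [lintegral_kernel_mul, mul_assoc]

/-- Commutator bound with a Lipschitz multiplication operator. -/
lemma energy_commutator_le_of_lip (m : 𝓢(V, ℂ)) {a h : 𝓢(V, ℂ)} (r : ℝ) {A : ℝ≥0∞}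
    (hA : A ≠ ∞) (ha : Lip A a) :
    energy ⇑(dil m r (sprod a h) - sprod a (dil m r h)) ≤
      kmom m 0 * kmom m 2 * (‖r‖ₑ ^ 2 * A ^ 2 * energy (V := V) h) := by
  refine energy_commutator_le m a h r fun y => ?_
  calc _ ≤ ∫⁻ x, (A * ‖r • y‖ₑ) ^ 2 * ‖h (x - r • y)‖ₑ ^ 2 := by
        gcongr with x
        refine (ha _ _).trans_eq ?_
        rw [sub_sub_cancel_left, enorm_neg]
    _ = _ := by
        rw [lintegral_const_mul' _ _ (by finiteness), energy_shift, enorm_smul]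
        ring

lemma ft_compSubConst (f : 𝓢(V, ℂ)) (z ξ : V) :
    ft (SchwartzMap.compSubConstCLM ℂ z f) ξ = Real.fourierChar (-inner ℝ z ξ) * ft f ξ := by
  rw [ft_coe, ft_coe, Real.fourier_eq, Real.fourier_eq, ← integral_const_mul,
    ← integral_sub_right_eq_self (fun v => _ * (Real.fourierChar (-inner ℝ v ξ) • f v)) z]
  refine integral_congr_ae (Eventually.of_forall fun v => ?_)
  simp only [Circle.smul_def, smul_eq_mul, ← mul_assoc, ← Circle.coe_mul,
    ← AddChar.map_add_eq_mul]
  refine congrArg₂ (· * ·) (congrArg _ (congrArg Real.fourierChar ?_)) rfl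
  rw [inner_sub_left]
  ring

lemma energy_sub_shift_le {a : 𝓢(V, ℂ)} {R : ℝ} (hR : 0 ≤ R)
    (ha : ∀ ξ, R < ‖ξ‖ → ft a ξ = 0) (z : V) :
    ∫⁻ x, ‖a (x - z) - a x‖ₑ ^ 2 ≤
      (ENNReal.ofReal (2 * Real.pi * R) * ‖z‖ₑ) ^ 2 * energy (V := V) a := by
  have e : ∫⁻ x, ‖a (x - z) - a x‖ₑ ^ 2 =
      energy ⇑(SchwartzMap.compSubConstCLM ℂ z a - a) := rfl
  rw [e, ← energy_ft, ← energy_ft a]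
  refine energy_le_of_enorm_le_mul (by finiteness) fun ξ => ?_
  rw [map_sub, sub_apply, ft_compSubConst, ← sub_one_mul, enorm_mul]
  rcases le_or_gt ‖ξ‖ R with h | h
  · gcongr
    rw [← ofReal_norm, ← ofReal_norm, ← ENNReal.ofReal_mul (by positivity)]
    refine ENNReal.ofReal_le_ofReal ?_
    rw [Real.fourierChar_apply]
    have := Real.norm_exp_I_mul_ofReal_sub_one_le (x := 2 * Real.pi * -inner ℝ z ξ)
    rw [mul_comm Complex.I] at this
    refine this.trans ?_
    rw [norm_mul, norm_neg, Real.norm_of_nonneg (by positivity : 0 ≤ 2 * Real.pi)]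
    calc _ ≤ 2 * Real.pi * (‖z‖ * ‖ξ‖) := by gcongr; exact norm_inner_le_norm z ξ
      _ ≤ 2 * Real.pi * (‖z‖ * R) := by gcongr
      _ = _ := by ring
  · simp [ha ξ h]

/-- Commutator bound with a frequency localized multiplication operator. -/
lemma energy_commutator_le_of_ft_eq_zero (m : 𝓢(V, ℂ)) {a h : 𝓢(V, ℂ)} (r : ℝ) {R : ℝ}
    {H : ℝ≥0∞} (hH : H ≠ ∞) (hR : 0 ≤ R) (ha : ∀ ξ, R < ‖ξ‖ → ft a ξ = 0)
    (hh : ∀ x, ‖h x‖ₑ ≤ H) :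
    energy ⇑(dil m r (sprod a h) - sprod a (dil m r h)) ≤
      kmom m 0 * kmom m 2 *
        ((ENNReal.ofReal (2 * Real.pi * R) * ‖r‖ₑ * H) ^ 2 * energy (V := V) a) := by
  refine energy_commutator_le m a h r fun y => ?_
  calc _ ≤ ∫⁻ x, ‖a (x - r • y) - a x‖ₑ ^ 2 * H ^ 2 := by
        gcongr with x
        exact hh _
    _ = (∫⁻ x, ‖a (x - r • y) - a x‖ₑ ^ 2) * H ^ 2 :=
        lintegral_mul_const' _ _ (by finiteness)
    _ ≤ ((ENNReal.ofReal (2 * Real.pi * R) * ‖r • y‖ₑ) ^ 2 * energy (V := V) a) * H ^ 2 := by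
        gcongr
        exact energy_sub_shift_le hR ha _
    _ = _ := by
        rw [enorm_smul]
        ring

end Kernel

section Symbols

variable {V : Type*} [NormedAddCommGroup V] [InnerProductSpace ℝ V] [FiniteDimensional ℝ V]

/-- A smooth function which is `1` on the unit ball and supported in the ball of radius `2`. -/
noncomputable def bump : V → ℝ := (⟨1, 2, one_pos, one_lt_two⟩ : ContDiffBump (0 : V))

lemma bump_eq_one {ξ : V} (h : ‖ξ‖ ≤ 1) : bump ξ = 1 :=
  ContDiffBump.one_of_mem_closedBall _ (by simpa using h)

lemma bump_eq_zero {ξ : V} (h : 2 ≤ ‖ξ‖) : bump ξ = 0 :=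
  ContDiffBump.zero_of_le_dist _ (by simpa using h)

lemma bump_nonneg (ξ : V) : 0 ≤ bump ξ := ContDiffBump.nonneg _

lemma bump_le_one (ξ : V) : bump ξ ≤ 1 := ContDiffBump.le_one _

lemma contDiff_bump : ContDiff ℝ (⊤ : ℕ∞) (bump : V → ℝ) := ContDiffBump.contDiff _

lemma hasCompactSupport_bump : HasCompactSupport (bump : V → ℝ) :=
  ContDiffBump.hasCompactSupport _

/-- A smooth cutoff to the annulus `a ≤ ‖ξ‖ ≤ 2 * b`, which is `1` for `2 * a ≤ ‖ξ‖ ≤ b`. -/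
noncomputable def cut (a b : ℝ) (ξ : V) : ℝ := bump (b⁻¹ • ξ) - bump (a⁻¹ • ξ)

omit [FiniteDimensional ℝ V] in
lemma norm_inv_smul {a : ℝ} (ha : 0 < a) (ξ : V) : ‖a⁻¹ • ξ‖ = ‖ξ‖ / a := by
  rw [norm_smul, norm_inv, Real.norm_of_nonneg ha.le, inv_mul_eq_div]

lemma cut_eq_zero_of_le {a b : ℝ} {ξ : V} (ha : 0 < a) (hab : a ≤ b) (h : ‖ξ‖ ≤ a) :
    cut a b ξ = 0 := by
  have hb : 0 < b := ha.trans_le hab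
  rw [cut, bump_eq_one, bump_eq_one, sub_self] <;>
    rw [norm_inv_smul (by assumption), div_le_one (by assumption)] <;> linarith

lemma cut_eq_zero_of_ge {a b : ℝ} {ξ : V} (ha : 0 < a) (hab : a ≤ b) (h : 2 * b ≤ ‖ξ‖) :
    cut a b ξ = 0 := by
  have hb : 0 < b := ha.trans_le hab
  rw [cut, bump_eq_zero, bump_eq_zero, sub_self] <;>
    rw [norm_inv_smul (by assumption), le_div_iff₀ (by assumption)] <;> linarith

lemma cut_eq_one {a b : ℝ} {ξ : V} (ha : 0 < a) (hb : 0 < b) (h : 2 * a ≤ ‖ξ‖) (h' : ‖ξ‖ ≤ b) :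
    cut a b ξ = 1 := by
  rw [cut, bump_eq_one, bump_eq_zero, sub_zero]
  · rwa [norm_inv_smul ha, le_div_iff₀ ha]
  · rwa [norm_inv_smul hb, div_le_one hb]

lemma cut_nonneg {a b : ℝ} (ha : 0 < a) (hab : 2 * a ≤ b) (ξ : V) : 0 ≤ cut a b ξ := by
  have hb : 0 < b := by linarith
  rcases le_total ‖ξ‖ b with h | h
  · rw [cut, bump_eq_one, sub_nonneg]
    · exact bump_le_one _
    · rwa [norm_inv_smul hb, div_le_one hb]
  · rw [cut, bump_eq_zero (ξ := a⁻¹ • ξ), sub_zero]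
    · exact bump_nonneg _
    · rw [norm_inv_smul ha, le_div_iff₀ ha]; linarith

lemma cut_le_one (a b : ℝ) (ξ : V) : cut a b ξ ≤ 1 := by
  have := bump_le_one (b⁻¹ • ξ)
  have := bump_nonneg (a⁻¹ • ξ)
  rw [cut]; linarith

lemma contDiff_cut (a b : ℝ) : ContDiff ℝ (⊤ : ℕ∞) (cut a b : V → ℝ) :=
  (contDiff_bump.comp (contDiff_const_smul _)).sub (contDiff_bump.comp (contDiff_const_smul _))

lemma contDiff_weight_mul_cut {w : V → ℂ} (hw : ∀ ξ ≠ 0, ContDiffAt ℝ (⊤ : ℕ∞) w ξ) {a b : ℝ}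
    (ha : 0 < a) (hab : a ≤ b) : ContDiff ℝ (⊤ : ℕ∞) (fun ξ => w ξ * (cut a b ξ : ℂ)) := by
  rw [contDiff_iff_contDiffAt]
  intro ξ
  rcases eq_or_ne ξ 0 with rfl | h
  · refine (contDiffAt_const (c := (0 : ℂ))).congr_of_eventuallyEq ?_
    filter_upwards [Metric.ball_mem_nhds (0 : V) ha] with η hη
    rw [cut_eq_zero_of_le ha hab ((mem_ball_zero_iff.1 hη).le)]
    simp
  · exact (hw ξ h).mul (Complex.ofRealCLM.contDiff.comp (contDiff_cut a b)).contDiffAt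

lemma hasCompactSupport_weight_mul_cut (w : V → ℂ) {a b : ℝ} (ha : 0 < a) (hab : a ≤ b) :
    HasCompactSupport (fun ξ => w ξ * (cut a b ξ : ℂ)) := by
  refine HasCompactSupport.of_support_subset_isCompact (isCompact_closedBall (0 : V) (2 * b))
    fun ξ hξ => ?_
  by_contra h
  rw [mem_closedBall_zero_iff, not_le] at h
  exact hξ (by simp [cut_eq_zero_of_ge ha hab h.le])

/-- The Schwartz function `w * cut a b`, when `w` is smooth away from the origin. -/
noncomputable def symb (w : V → ℂ) (a b : ℝ) : 𝓢(V, ℂ) :=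
  open Classical in
  if h : (∀ ξ ≠ 0, ContDiffAt ℝ (⊤ : ℕ∞) w ξ) ∧ 0 < a ∧ a ≤ b then
    (hasCompactSupport_weight_mul_cut w h.2.1 h.2.2).toSchwartzMap
      (contDiff_weight_mul_cut h.1 h.2.1 h.2.2)
  else 0

lemma symb_apply {w : V → ℂ} (hw : ∀ ξ ≠ 0, ContDiffAt ℝ (⊤ : ℕ∞) w ξ) {a b : ℝ}
    (ha : 0 < a) (hab : a ≤ b) (ξ : V) : symb w a b ξ = w ξ * (cut a b ξ : ℂ) := by
  rw [symb, dif_pos ⟨hw, ha, hab⟩]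
  rfl

/-- The bump function as a Schwartz function. -/
noncomputable def phi : 𝓢(V, ℂ) :=
  HasCompactSupport.toSchwartzMap (f := fun ξ : V => (bump ξ : ℂ))
    (hasCompactSupport_bump.comp_left (g := fun t : ℝ => (t : ℂ)) rfl)
    (Complex.ofRealCLM.contDiff.comp contDiff_bump)

lemma phi_apply (ξ : V) : phi ξ = (bump ξ : ℂ) := rfl

/-- The cutoff functions as Schwartz functions. -/
noncomputable def psi (a b : ℝ) : 𝓢(V, ℂ) := symb (fun _ => 1) a b

lemma psi_apply {a b : ℝ} (ha : 0 < a) (hab : a ≤ b) (ξ : V) :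
    psi a b ξ = (cut a b ξ : ℂ) := by
  rw [psi, symb_apply (w := fun _ => 1) (fun _ _ => contDiffAt_const) ha hab, one_mul]

omit [FiniteDimensional ℝ V] in
lemma contDiffAt_norm_rpow (s : ℝ) (ξ : V) (h : ξ ≠ 0) :
    ContDiffAt ℝ (⊤ : ℕ∞) (fun ξ : V => ((‖ξ‖ ^ s : ℝ) : ℂ)) ξ :=
  Complex.ofRealCLM.contDiff.contDiffAt.comp ξ
    ((contDiffAt_norm ℝ h).rpow_const_of_ne (norm_ne_zero_iff.2 h))

/-- The symbol `‖ξ‖ ^ s` localized to an annulus. -/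
noncomputable def rho (s : ℝ) : 𝓢(V, ℂ) := symb (fun ξ => ((‖ξ‖ ^ s : ℝ) : ℂ)) (1 / 8) 16

lemma rho_apply (s : ℝ) (ξ : V) :
    rho s ξ = ((‖ξ‖ ^ s : ℝ) : ℂ) * (cut (1 / 8) 16 ξ : ℂ) :=
  symb_apply (contDiffAt_norm_rpow s) (by norm_num) (by norm_num) ξ

lemma rho_eq (s : ℝ) {ξ : V} (h : 1 / 4 ≤ ‖ξ‖) (h' : ‖ξ‖ ≤ 16) :
    rho s ξ = ((‖ξ‖ ^ s : ℝ) : ℂ) := by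
  rw [rho_apply, cut_eq_one (by norm_num) (by norm_num) (by linarith) h']
  simp

lemma enorm_rho_le {s : ℝ} (hs : 0 ≤ s) (ξ : V) : ‖rho s ξ‖ₑ ≤ ENNReal.ofReal (32 ^ s) := by
  rw [← ofReal_norm]
  refine ENNReal.ofReal_le_ofReal ?_
  rw [rho_apply, norm_mul, Complex.norm_real, Complex.norm_real,
    Real.norm_of_nonneg (by positivity)]
  rcases le_total ‖ξ‖ 32 with h | h
  · rw [Real.norm_of_nonneg (cut_nonneg (by norm_num) (by norm_num) ξ)]
    calc _ ≤ (32 : ℝ) ^ s * 1 := by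
          gcongr
          · exact cut_nonneg (by norm_num) (by norm_num) ξ
          · exact cut_le_one _ _ ξ
      _ = _ := mul_one _
  · rw [cut_eq_zero_of_ge (ξ := ξ) (by norm_num) (by norm_num) (by linarith)]
    simp
    positivity

end Symbols

section Pieces

/-- The dyadic scale `2 ^ n * lam`. -/
noncomputable def sc (lam : ℝ) (n : ℕ) : ℝ := 2 ^ n * lam

lemma sc_pos {lam : ℝ} (h : 0 < lam) (n : ℕ) : 0 < sc lam n := by unfold sc; positivity

lemma sc_add (lam : ℝ) (n d : ℕ) : sc lam (n + d) = 2 ^ d * sc lam n := by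
  unfold sc; rw [pow_add]; ring

lemma sc_mono {lam : ℝ} (h : 0 < lam) {m n : ℕ} (hmn : m ≤ n) : sc lam m ≤ sc lam n := by
  unfold sc; gcongr; norm_num

/-- The dyadic scale as an extended nonnegative real. -/
noncomputable def esc (lam : ℝ) (n : ℕ) : ℝ≥0∞ := ENNReal.ofReal (sc lam n)

lemma esc_ne_zero {lam : ℝ} (h : 0 < lam) (n : ℕ) : esc lam n ≠ 0 := by
  simpa [esc] using sc_pos h n

lemma esc_ne_top (lam : ℝ) (n : ℕ) : esc lam n ≠ ∞ := ENNReal.ofReal_ne_top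

lemma esc_add (lam : ℝ) (n d : ℕ) : esc lam (n + d) = 2 ^ d * esc lam n := by
  rw [esc, sc_add, ENNReal.ofReal_mul (by positivity), esc, ENNReal.ofReal_pow (by norm_num)]
  simp

lemma esc_rpow_ne_top {lam : ℝ} (h : 0 < lam) (n : ℕ) (t : ℝ) : esc lam n ^ t ≠ ∞ :=
  ENNReal.rpow_ne_top_of_ne_zero (esc_ne_zero h n) (esc_ne_top lam n)

lemma enorm_sc {lam : ℝ} (h : 0 < lam) (n : ℕ) : ‖sc lam n‖ₑ = esc lam n :=
  Real.enorm_of_nonneg (sc_pos h n).le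

lemma enorm_inv_sc {lam : ℝ} (h : 0 < lam) (n : ℕ) : ‖(sc lam n)⁻¹‖ₑ = (esc lam n)⁻¹ := by
  rw [enorm_inv (sc_pos h n).ne', enorm_sc h]

lemma sum_range_sub_le {u : ℕ → ℝ} (h0 : ∀ n, 0 ≤ u n) (h1 : ∀ n, u n ≤ 1) (d N : ℕ) :
    ∑ j ∈ Finset.range N, (u (j + d) - u j) ≤ d := by
  induction d with
  | zero => simp
  | succ d ih =>
    have h2 : ∑ j ∈ Finset.range N, (u (j + (d + 1)) - u (j + d)) = u (N + d) - u (0 + d) := by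
      rw [← Finset.sum_range_sub (fun j => u (j + d))]
      exact Finset.sum_congr rfl fun j _ => by congr 2; ring
    have h3 : ∑ j ∈ Finset.range N, (u (j + (d + 1)) - u j) =
        ∑ j ∈ Finset.range N, (u (j + (d + 1)) - u (j + d)) +
          ∑ j ∈ Finset.range N, (u (j + d) - u j) := by
      rw [← Finset.sum_add_distrib]
      exact Finset.sum_congr rfl fun j _ => by ring
    rw [h3, h2]
    push_cast
    linarith [h0 (0 + d), h1 (N + d)]

variable {V : Type*} [NormedAddCommGroup V] [InnerProductSpace ℝ V] [FiniteDimensional ℝ V]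

lemma sum_cut_le (lam : ℝ) {a : ℝ} (ha : 0 < a) {d : ℕ} (hd : 1 ≤ d)
    (I : Finset ℕ) (ξ : V) :
    ∑ j ∈ I, cut a (2 ^ d * a) ((sc lam j)⁻¹ • ξ) ≤ d := by
  obtain ⟨N, hN⟩ := I.exists_nat_subset_range
  have hab : 2 * a ≤ 2 ^ d * a := by
    gcongr
    exact le_self_pow₀ (by norm_num) (by omega)
  refine (Finset.sum_le_sum_of_subset_of_nonneg hN fun j _ _ => cut_nonneg ha hab _).trans ?_
  refine le_of_eq_of_le ?_ (sum_range_sub_le (u := fun j => bump ((a * sc lam j)⁻¹ • ξ))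
    (fun _ => bump_nonneg _) (fun _ => bump_le_one _) d N)
  refine Finset.sum_congr rfl fun j _ => ?_
  simp only [cut, smul_smul, sc_add, ← mul_inv]
  congr 4
  ring

lemma sum_psi_sq_le (lam : ℝ) {a b : ℝ} (ha : 0 < a) {d : ℕ} (hd : 1 ≤ d)
    (hb : b = 2 ^ d * a) (I : Finset ℕ) (ξ : V) :
    ∑ j ∈ I, ‖psi a b ((sc lam j)⁻¹ • ξ)‖ₑ ^ 2 ≤ d := by
  subst hb
  have hab : 2 * a ≤ 2 ^ d * a := by
    gcongr
    exact le_self_pow₀ (by norm_num) (by omega)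
  have h0 := fun ξ : V => cut_nonneg ha hab ξ
  calc _ ≤ ∑ j ∈ I, ENNReal.ofReal (cut a (2 ^ d * a) ((sc lam j)⁻¹ • ξ)) := by
        refine Finset.sum_le_sum fun j _ => ?_
        rw [psi_apply ha (by linarith), ← ofReal_norm, Complex.norm_real,
          Real.norm_of_nonneg (h0 _), ← ENNReal.ofReal_pow (h0 _)]
        exact ENNReal.ofReal_le_ofReal (pow_le_of_le_one (h0 _) (cut_le_one _ _ _) two_ne_zero)
    _ = ENNReal.ofReal (∑ j ∈ I, cut a (2 ^ d * a) ((sc lam j)⁻¹ • ξ)) :=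
        (ENNReal.ofReal_sum_of_nonneg fun _ _ => h0 _).symm
    _ ≤ ENNReal.ofReal d := ENNReal.ofReal_le_ofReal (sum_cut_le lam ha hd I ξ)
    _ = d := ENNReal.ofReal_natCast d

/-- Multiplication by the weight `‖ξ‖ ^ t`. -/
noncomputable def wt (t : ℝ) (u : V → ℂ) (ξ : V) : ℂ := ((‖ξ‖ ^ t : ℝ) : ℂ) * u ξ

omit [InnerProductSpace ℝ V] [FiniteDimensional ℝ V] in
lemma enorm_wt {t : ℝ} (ht : 0 ≤ t) (u : V → ℂ) (ξ : V) :
    ‖wt t u ξ‖ₑ = ‖ξ‖ₑ ^ t * ‖u ξ‖ₑ := by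
  rw [wt, enorm_mul, ← ofReal_norm, Complex.norm_real, Real.norm_of_nonneg (by positivity),
    ← ENNReal.ofReal_rpow_of_nonneg (norm_nonneg _) ht, ofReal_norm]

variable [MeasurableSpace V] [BorelSpace V]

/-- The square of the homogeneous Sobolev norm of order `t`. -/
noncomputable def sob (t : ℝ) (f : 𝓢(V, ℂ)) : ℝ≥0∞ := energy (wt t (ft f))

/-- The frequency localization at scale `sc lam n`. -/
noncomputable def pp (lam : ℝ) (n : ℕ) : 𝓢(V, ℂ) →L[ℂ] 𝓢(V, ℂ) := dil (psi 1 2) (sc lam n)⁻¹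

/-- The wide frequency localization at scale `sc lam n`. -/
noncomputable def ww (lam : ℝ) (n : ℕ) : 𝓢(V, ℂ) →L[ℂ] 𝓢(V, ℂ) :=
  dil (psi (1 / 4) 8) (sc lam n)⁻¹

/-- The localization to frequencies below the scale `sc lam n`. -/
noncomputable def ss (lam : ℝ) (n : ℕ) : 𝓢(V, ℂ) →L[ℂ] 𝓢(V, ℂ) := dil phi (sc lam n)⁻¹

lemma pp_eq (lam : ℝ) (n : ℕ) (f : 𝓢(V, ℂ)) : pp lam n f = ss lam (n + 1) f - ss lam n f := by
  refine eq_of_ft_eq fun ξ => ?_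
  rw [map_sub, sub_apply, pp, ss, ss, ft_dil_apply, ft_dil_apply, ft_dil_apply, ← sub_mul,
    psi_apply one_pos one_le_two, phi_apply, phi_apply, ← Complex.ofReal_sub, cut, smul_smul,
    smul_smul, sc_add, ← mul_inv, ← mul_inv, pow_one, one_mul]

lemma ww_eq (lam : ℝ) (n : ℕ) (f : 𝓢(V, ℂ)) :
    ww lam (n + 2) f = ss lam (n + 5) f - ss lam n f := by
  refine eq_of_ft_eq fun ξ => ?_
  rw [map_sub, sub_apply, ww, ss, ss, ft_dil_apply, ft_dil_apply, ft_dil_apply, ← sub_mul,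
    psi_apply (by norm_num) (by norm_num), phi_apply, phi_apply, ← Complex.ofReal_sub, cut,
    smul_smul, smul_smul, sc_add, sc_add, ← mul_inv, ← mul_inv]
  ring_nf

lemma sum_pp (lam : ℝ) {a b : ℕ} (hab : a ≤ b) (f : 𝓢(V, ℂ)) :
    ∑ j ∈ Finset.Ico a b, pp lam j f = ss lam b f - ss lam a f := by
  simp_rw [pp_eq]
  exact Finset.sum_Ico_sub (fun j => ss lam j f) hab

lemma ww_eq_sum (lam : ℝ) (n : ℕ) (f : 𝓢(V, ℂ)) :
    ww lam (n + 2) f = ∑ j ∈ Finset.Ico n (n + 5), pp lam j f := by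
  rw [ww_eq, sum_pp lam (by omega)]

lemma ft_dil_psi_eq_zero {lam : ℝ} (hlam : 0 < lam) {a b : ℝ} (ha : 0 < a) (hab : a ≤ b)
    {n : ℕ} {f : 𝓢(V, ℂ)} {ξ : V} (h : ‖ξ‖ ≤ a * sc lam n ∨ 2 * b * sc lam n ≤ ‖ξ‖) :
    ft (dil (psi a b) (sc lam n)⁻¹ f) ξ = 0 := by
  have hs := sc_pos hlam n
  rw [ft_dil_apply, psi_apply ha hab]
  rcases h with h | h
  · rw [cut_eq_zero_of_le ha hab]
    · simp
    · rwa [norm_inv_smul hs, div_le_iff₀ hs]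
  · rw [cut_eq_zero_of_ge ha hab]
    · simp
    · rwa [norm_inv_smul hs, le_div_iff₀ hs]

lemma ft_pp_eq_zero {lam : ℝ} (hlam : 0 < lam) {n : ℕ} {f : 𝓢(V, ℂ)} {ξ : V}
    (h : ‖ξ‖ ≤ sc lam n ∨ 4 * sc lam n ≤ ‖ξ‖) : ft (pp lam n f) ξ = 0 :=
  ft_dil_psi_eq_zero hlam one_pos one_le_two (by
    rcases h with h | h
    · left; linarith
    · right; linarith)

lemma ft_ww_eq_zero {lam : ℝ} (hlam : 0 < lam) {n : ℕ} {f : 𝓢(V, ℂ)} {ξ : V}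
    (h : ‖ξ‖ ≤ sc lam n / 4 ∨ 16 * sc lam n ≤ ‖ξ‖) : ft (ww lam n f) ξ = 0 :=
  ft_dil_psi_eq_zero hlam (by norm_num) (by norm_num) (by
    rcases h with h | h
    · left; linarith
    · right; linarith)

lemma sum_energy_dil_psi_le {lam : ℝ} (hlam : 0 < lam) {a b : ℝ} (ha : 0 < a) {d : ℕ}
    (hd : 1 ≤ d) (hb : b = 2 ^ d * a) {t : ℝ} (ht : 0 ≤ t) (I : Finset ℕ) (f : 𝓢(V, ℂ)) :
    ∑ j ∈ I, (esc lam j ^ t) ^ 2 * energy (V := V) (dil (psi a b) (sc lam j)⁻¹ f) ≤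
      (ENNReal.ofReal (a⁻¹) ^ t) ^ 2 * d * sob t f := by
  have hab : a ≤ b := by
    rw [hb]
    exact le_mul_of_one_le_left ha.le (one_le_pow₀ one_le_two)
  have hm : ∀ j, Measurable fun ξ => ‖ft (dil (psi a b) (sc lam j)⁻¹ f) ξ‖ₑ ^ 2 := fun j =>
    (ft (dil (psi a b) (sc lam j)⁻¹ f)).continuous.measurable.enorm.pow_const 2
  have hwt : Measurable (wt t (ft f) : V → ℂ) := by
    unfold wt
    have := (ft f).continuous
    fun_prop
  simp_rw [← energy_ft (dil (psi a b) _ f), energy]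
  simp_rw [← lintegral_const_mul _ (hm _)]
  rw [← lintegral_finsetSum _ (fun j _ => (hm j).const_mul _), sob, energy,
    ← lintegral_const_mul _ (hwt.enorm.pow_const 2)]
  refine lintegral_mono fun ξ => ?_
  calc _ ≤ ∑ j ∈ I, ‖psi a b ((sc lam j)⁻¹ • ξ)‖ₑ ^ 2 *
        (ENNReal.ofReal a⁻¹ ^ t * ‖wt t (ft f) ξ‖ₑ) ^ 2 := by
        refine Finset.sum_le_sum fun j _ => ?_
        rw [← mul_pow, ← mul_pow]
        gcongr ?_ ^ 2
        rcases le_or_gt ‖ξ‖ (a * sc lam j) with h | h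
        · rw [ft_dil_psi_eq_zero hlam ha hab (Or.inl h)]
          simp
        rw [ft_dil_apply, enorm_mul, enorm_wt ht, mul_left_comm, ← mul_assoc (_ ^ t) (_ ^ t),
          ← ENNReal.mul_rpow_of_nonneg _ _ ht, ← ofReal_norm ξ, esc,
          ← ENNReal.ofReal_mul (by positivity)]
        gcongr
        rw [inv_mul_eq_div, le_div_iff₀ ha, mul_comm]
        exact h.le
    _ = (∑ j ∈ I, ‖psi a b ((sc lam j)⁻¹ • ξ)‖ₑ ^ 2) *
        (ENNReal.ofReal a⁻¹ ^ t * ‖wt t (ft f) ξ‖ₑ) ^ 2 := by rw [Finset.sum_mul]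
    _ ≤ d * (ENNReal.ofReal a⁻¹ ^ t * ‖wt t (ft f) ξ‖ₑ) ^ 2 := by
        gcongr
        exact sum_psi_sq_le lam ha hd hb I ξ
    _ = _ := by ring

lemma sum_energy_pp_le {lam : ℝ} (hlam : 0 < lam) {t : ℝ} (ht : 0 ≤ t) (I : Finset ℕ)
    (f : 𝓢(V, ℂ)) :
    ∑ j ∈ I, (esc lam j ^ t) ^ 2 * energy (V := V) (pp lam j f) ≤ sob t f := by
  have := sum_energy_dil_psi_le hlam one_pos le_rfl (b := 2) (by norm_num) ht I f
  simpa [pp] using this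

lemma sum_energy_ww_le {lam : ℝ} (hlam : 0 < lam) {t : ℝ} (ht : 0 ≤ t) (I : Finset ℕ)
    (f : 𝓢(V, ℂ)) :
    ∑ j ∈ I, (esc lam j ^ t) ^ 2 * energy (V := V) (ww lam j f) ≤
      (4 ^ t) ^ 2 * 5 * sob t f := by
  have := sum_energy_dil_psi_le hlam (a := 1 / 4) (d := 5) (by norm_num) (by norm_num) (b := 8)
    (by norm_num) ht I f
  simpa [ww] using this

lemma enorm_pp_le {lam : ℝ} {f : 𝓢(V, ℂ)} {G : ℝ≥0∞} (hf : ∀ x, ‖f x‖ₑ ≤ G) (n : ℕ) (x : V) :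
    ‖pp lam n f x‖ₑ ≤ kmom (psi (V := V) 1 2) 0 * G := enorm_dil_le hf x

lemma enorm_ww_le {lam : ℝ} {f : 𝓢(V, ℂ)} {G : ℝ≥0∞} (hf : ∀ x, ‖f x‖ₑ ≤ G) (n : ℕ) (x : V) :
    ‖ww lam n f x‖ₑ ≤ kmom (psi (V := V) (1 / 4) 8) 0 * G := enorm_dil_le hf x

lemma enorm_pp_le_of_lip {lam : ℝ} (hlam : 0 < lam) {f : 𝓢(V, ℂ)} {A : ℝ≥0∞} (hf : Lip A f)
    (n : ℕ) (x : V) :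
    ‖pp lam n f x‖ₑ ≤ kmom (psi (V := V) 1 2) 1 * ((esc lam n)⁻¹ * A) := by
  rw [← enorm_inv_sc hlam]
  refine enorm_dil_le_of_lip ?_ hf x
  rw [psi_apply one_pos one_le_two, cut_eq_zero_of_le one_pos one_le_two (by simp)]
  simp

lemma enorm_sum_pp_le {lam : ℝ} {f : 𝓢(V, ℂ)} {G : ℝ≥0∞} (hf : ∀ x, ‖f x‖ₑ ≤ G) (a b : ℕ)
    (x : V) : ‖(∑ j ∈ Finset.Ico a b, pp lam j f) x‖ₑ ≤ 2 * kmom (phi (V := V)) 0 * G := by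
  rcases le_total a b with h | h
  · rw [sum_pp lam h, sub_apply, two_mul, add_mul]
    exact enorm_sub_le.trans (add_le_add (enorm_dil_le hf x) (enorm_dil_le hf x))
  · simp [Finset.Ico_eq_empty_of_le h]

lemma lip_sum_pp {lam : ℝ} {f : 𝓢(V, ℂ)} {A : ℝ≥0∞} (hf : Lip A f) (a b : ℕ) :
    Lip (2 * kmom (phi (V := V)) 0 * A) (∑ j ∈ Finset.Ico a b, pp lam j f : 𝓢(V, ℂ)) := by
  intro x y
  rcases le_total a b with h | h
  · rw [sum_pp lam h, sub_apply, sub_apply, sub_sub_sub_comm, two_mul, add_mul, add_mul]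
    exact enorm_sub_le.trans (add_le_add (lip_dil hf x y) (lip_dil hf x y))
  · simp [Finset.Ico_eq_empty_of_le h]

/-- The fractional derivative of order `s` on functions with frequencies of size `sc lam n`. -/
noncomputable def frac (s lam : ℝ) (n : ℕ) : 𝓢(V, ℂ) →L[ℂ] 𝓢(V, ℂ) :=
  ((sc lam n ^ s : ℝ) : ℂ) • dil (rho s) (sc lam n)⁻¹

lemma frac_apply (s lam : ℝ) (n : ℕ) (u : 𝓢(V, ℂ)) (x : V) :
    frac s lam n u x = ((sc lam n ^ s : ℝ) : ℂ) * dil (rho s) (sc lam n)⁻¹ u x := rfl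

lemma ft_frac_apply (s lam : ℝ) (n : ℕ) (u : 𝓢(V, ℂ)) (x : V) :
    ft (frac s lam n u) x = ((sc lam n ^ s : ℝ) : ℂ) * ft (dil (rho s) (sc lam n)⁻¹ u) x := by
  rw [frac, smul_apply, map_smul, smul_apply, smul_eq_mul]

lemma ft_frac {s lam : ℝ} (hlam : 0 < lam) {n : ℕ} {u : 𝓢(V, ℂ)}
    (hu : ∀ ξ, ‖ξ‖ < sc lam n / 4 ∨ 16 * sc lam n < ‖ξ‖ → ft u ξ = 0) (ξ : V) :
    ft (frac s lam n u) ξ = wt s (ft u) ξ := by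
  have hs := sc_pos hlam n
  rw [ft_frac_apply, ft_dil_apply, wt]
  by_cases h : ‖ξ‖ < sc lam n / 4 ∨ 16 * sc lam n < ‖ξ‖
  · simp [hu ξ h]
  push Not at h
  rw [rho_eq, ← mul_assoc, ← Complex.ofReal_mul, ← Real.mul_rpow hs.le (norm_nonneg _),
    norm_inv_smul hs, mul_div_cancel₀ _ hs.ne']
  · rw [norm_inv_smul hs, le_div_iff₀ hs]; linarith
  · rw [norm_inv_smul hs, div_le_iff₀ hs]; linarith

lemma enorm_sc_rpow {lam : ℝ} (hlam : 0 < lam) (s : ℝ) (n : ℕ) :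
    ‖((sc lam n ^ s : ℝ) : ℂ)‖ₑ = esc lam n ^ s := by
  rw [← ofReal_norm, Complex.norm_real, Real.norm_of_nonneg (by have := sc_pos hlam n; positivity),
    esc, ENNReal.ofReal_rpow_of_pos (sc_pos hlam n)]

lemma enorm_frac_le {s lam : ℝ} (hlam : 0 < lam) {u : 𝓢(V, ℂ)} {G : ℝ≥0∞}
    (hu : ∀ x, ‖u x‖ₑ ≤ G) (n : ℕ) (x : V) :
    ‖frac s lam n u x‖ₑ ≤ esc lam n ^ s * (kmom (rho (V := V) s) 0 * G) := by
  rw [frac_apply, enorm_mul, enorm_sc_rpow hlam]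
  gcongr
  exact enorm_dil_le hu x

lemma energy_frac_le {s lam : ℝ} (hlam : 0 < lam) (hs : 0 ≤ s) (n : ℕ) (u : 𝓢(V, ℂ)) :
    energy (V := V) (frac s lam n u) ≤
      (esc lam n ^ s) ^ 2 * (ENNReal.ofReal (32 ^ s) ^ 2 * energy (V := V) u) := by
  have h : (frac s lam n u : V → ℂ) = fun x =>
    ((sc lam n ^ s : ℝ) : ℂ) * dil (rho s) (sc lam n)⁻¹ u x := rfl
  rw [h, energy_const_mul, enorm_sc_rpow hlam]
  gcongr
  exact energy_dil_le ENNReal.ofReal_ne_top (enorm_rho_le hs) u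

end Pieces

section Schur

lemma sum_geometric_right_le (θ : ℝ≥0∞) (I : Finset ℕ) (p : ℕ) :
    ∑ q ∈ I with p ≤ q, θ ^ (q - p) ≤ (1 - θ)⁻¹ := by
  rw [← ENNReal.tsum_geometric, ← Finset.sum_image (g := fun q => q - p) (f := fun n => θ ^ n)]
  · exact ENNReal.sum_le_tsum _
  · intro a ha b hb hab
    simp only [Finset.coe_filter, Set.mem_ofPred_eq] at ha hb hab
    omega

lemma sum_geometric_left_le (θ : ℝ≥0∞) (I : Finset ℕ) (q : ℕ) :
    ∑ p ∈ I with p ≤ q, θ ^ (q - p) ≤ (1 - θ)⁻¹ := by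
  rw [← ENNReal.tsum_geometric, ← Finset.sum_image (g := fun p => q - p) (f := fun n => θ ^ n)]
  · exact ENNReal.sum_le_tsum _
  · intro a ha b hb hab
    simp only [Finset.coe_filter, Set.mem_ofPred_eq] at ha hb hab
    omega

lemma mul_le_sq_add_sq (a b : ℝ≥0∞) : a * b ≤ a ^ 2 + b ^ 2 := by
  rcases le_total a b with h | h
  · calc _ ≤ b * b := by gcongr
      _ ≤ _ := by rw [← sq]; exact le_add_self
  · calc _ ≤ a * a := by gcongr
      _ ≤ _ := by rw [← sq]; exact le_self_add

variable {V : Type*} [NormedAddCommGroup V] [InnerProductSpace ℝ V] [FiniteDimensional ℝ V]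
  [MeasurableSpace V] [BorelSpace V]

lemma energy_add_le {u v : V → ℂ} (hu : Measurable u) :
    energy (fun x => u x + v x) ≤ 2 * (energy u + energy v) := by
  rw [energy, energy, energy, ← lintegral_add_left (hu.enorm.pow_const 2),
    ← lintegral_const_mul' _ _ (by finiteness)]
  refine lintegral_mono fun x => ?_
  calc ‖u x + v x‖ₑ ^ 2 ≤ (‖u x‖ₑ + ‖v x‖ₑ) ^ 2 := by gcongr; exact enorm_add_le _ _
    _ ≤ 2 * (‖u x‖ₑ ^ 2 + ‖v x‖ₑ ^ 2) := by
        have := ENNReal.rpow_add_le_mul_rpow_add_rpow ‖u x‖ₑ ‖v x‖ₑ one_le_two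
        norm_num at this
        exact this

lemma energy_neg (u : V → ℂ) : energy (fun x => - u x) = energy u := by simp [energy]

lemma energy_sub_le {u v : V → ℂ} (hu : Measurable u) :
    energy (fun x => u x - v x) ≤ 2 * (energy u + energy v) := by
  simpa [sub_eq_add_neg, energy_neg] using energy_add_le (v := fun x => - v x) hu

lemma lintegral_enorm_mul_le (u v : V → ℂ) (hu : Measurable u) :
    ∫⁻ x, ‖u x‖ₑ * ‖v x‖ₑ ≤ energy u + energy v := by
  rw [energy, energy, ← lintegral_add_left (hu.enorm.pow_const 2)]
  exact lintegral_mono fun x => mul_le_sq_add_sq _ _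

lemma energy_sum_le_sum_lintegral {D : ℕ → V → ℂ} (hD : ∀ j, Measurable (D j)) (I : Finset ℕ) :
    energy (fun x => ∑ p ∈ I, D p x) ≤
      2 * ∑ p ∈ I, ∑ q ∈ I with p ≤ q, ∫⁻ x, ‖D p x‖ₑ * ‖D q x‖ₑ := by
  set B : ℕ → ℕ → ℝ≥0∞ := fun p q => ∫⁻ x, ‖D p x‖ₑ * ‖D q x‖ₑ with hB
  have hsymm : ∀ p q, B p q = B q p := fun p q => by simp only [hB, mul_comm]
  calc energy (fun x => ∑ p ∈ I, D p x)
      ≤ ∫⁻ x, ∑ p ∈ I, ∑ q ∈ I, ‖D p x‖ₑ * ‖D q x‖ₑ := by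
        refine lintegral_mono fun x => ?_
        rw [← Finset.sum_mul_sum, ← sq]
        gcongr
        exact enorm_sum_le _ _
    _ = ∑ p ∈ I, ∑ q ∈ I, B p q := by
        have hm : ∀ p q, Measurable fun x => ‖D p x‖ₑ * ‖D q x‖ₑ := fun p q =>
          (hD p).enorm.mul (hD q).enorm
        refine (lintegral_finsetSum _ fun p _ => Finset.measurable_fun_sum _ fun q _ =>
          hm p q).trans ?_
        exact Finset.sum_congr rfl fun p _ => lintegral_finsetSum _ fun q _ => hm p q
    _ ≤ ∑ p ∈ I, ∑ q ∈ I, ((if p ≤ q then B p q else 0) + if q ≤ p then B q p else 0) := by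
        refine Finset.sum_le_sum fun p _ => Finset.sum_le_sum fun q _ => ?_
        rcases le_total p q with h | h
        · rw [if_pos h]; exact le_self_add
        · rw [if_pos h, hsymm]; exact le_add_self
    _ = _ := by
        simp_rw [Finset.sum_add_distrib]
        rw [Finset.sum_comm (f := fun p q => if q ≤ p then B q p else 0), ← two_mul]
        simp_rw [Finset.sum_filter]
        rfl

/-- The Schur test with geometric off-diagonal decay. -/
lemma energy_sum_le {D : ℕ → V → ℂ} (hD : ∀ j, Measurable (D j)) {K θ : ℝ≥0∞} {e : ℕ → ℝ≥0∞}
    {I : Finset ℕ} (h : ∀ p ∈ I, ∀ q ∈ I, p ≤ q →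
      ∫⁻ x, ‖D p x‖ₑ * ‖D q x‖ₑ ≤ K * θ ^ (q - p) * (e p + e q)) :
    energy (fun x => ∑ p ∈ I, D p x) ≤ 4 * K * (1 - θ)⁻¹ * ∑ p ∈ I, e p := by
  refine (energy_sum_le_sum_lintegral hD I).trans ?_
  calc _ ≤ 2 * ∑ p ∈ I, ∑ q ∈ I with p ≤ q, K * θ ^ (q - p) * (e p + e q) := by
        gcongr with p hp q hq
        rw [Finset.mem_filter] at hq
        exact h p hp q hq.1 hq.2
    _ = 2 * K * (∑ p ∈ I, (∑ q ∈ I with p ≤ q, θ ^ (q - p)) * e p +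
          ∑ q ∈ I, (∑ p ∈ I with p ≤ q, θ ^ (q - p)) * e q) := by
        have h1 : ∑ q ∈ I, (∑ p ∈ I with p ≤ q, θ ^ (q - p)) * e q =
            ∑ p ∈ I, ∑ q ∈ I with p ≤ q, θ ^ (q - p) * e q := by
          simp_rw [Finset.sum_mul, Finset.sum_filter]
          exact Finset.sum_comm
        rw [h1, ← Finset.sum_add_distrib]
        simp_rw [Finset.sum_mul, ← Finset.sum_add_distrib, Finset.mul_sum]
        exact Finset.sum_congr rfl fun p _ => Finset.sum_congr rfl fun q _ => by ring
    _ ≤ 2 * K * (∑ p ∈ I, (1 - θ)⁻¹ * e p + ∑ q ∈ I, (1 - θ)⁻¹ * e q) := by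
        gcongr with p _ q _
        · exact sum_geometric_right_le θ I p
        · exact sum_geometric_left_le θ I q
    _ = _ := by
        rw [← two_mul, ← Finset.mul_sum]
        ring

lemma one_sub_half_inv : (1 - 2⁻¹ : ℝ≥0∞)⁻¹ = 2 := by
  rw [ENNReal.one_sub_inv_two, inv_inv]

/-- Almost orthogonality for functions with nearly disjoint supports. -/
lemma energy_sum_le_of_disjoint {D : ℕ → V → ℂ} (hD : ∀ j, Measurable (D j)) {I : Finset ℕ}
    (h : ∀ p q, p + 4 ≤ q → ∀ x, D p x = 0 ∨ D q x = 0) :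
    energy (fun x => ∑ p ∈ I, D p x) ≤ 128 * ∑ p ∈ I, energy (D p) := by
  have := energy_sum_le hD (K := 16) (θ := 2⁻¹) (e := fun p => energy (D p)) (I := I) ?_
  · refine this.trans_eq ?_
    rw [one_sub_half_inv]
    norm_num
  · intro p _ q _ hpq
    rcases lt_or_ge q (p + 4) with hq | hq
    · refine (lintegral_enorm_mul_le _ _ (hD p)).trans ?_
      refine le_mul_of_one_le_left zero_le ?_
      have h16 : (16 : ℝ≥0∞) = 2 ^ 4 := by norm_num
      rw [← ENNReal.inv_pow, ← div_eq_mul_inv, h16]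
      rw [ENNReal.le_div_iff_mul_le (by simp) (by simp), one_mul]
      exact pow_le_pow_right₀ (by norm_num) (by omega)
    · have : ∀ x, ‖D p x‖ₑ * ‖D q x‖ₑ = 0 := fun x => by
        rcases h p q hq x with h | h <;> simp [h]
      simp [this]

end Schur

section Carleson

variable {V : Type*} [NormedAddCommGroup V] [InnerProductSpace ℝ V] [FiniteDimensional ℝ V]
  [MeasurableSpace V] [BorelSpace V]

omit [FiniteDimensional ℝ V] in
lemma measurable_coe (f : 𝓢(V, ℂ)) : Measurable (f : V → ℂ) := f.continuous.measurable

lemma energy_sprod_le_left {a h : 𝓢(V, ℂ)} {H : ℝ≥0∞} (hH : H ≠ ∞) (hh : ∀ x, ‖h x‖ₑ ≤ H) :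
    energy (V := V) (sprod a h) ≤ H ^ 2 * energy (V := V) a :=
  energy_le_of_enorm_le_mul hH fun x => by
    rw [sprod_apply, enorm_mul, mul_comm]; gcongr; exact hh x

lemma esc_mul_inv {lam : ℝ} (hlam : 0 < lam) {p q : ℕ} (h : p ≤ q) :
    esc lam p * (esc lam q)⁻¹ = 2⁻¹ ^ (q - p) := by
  obtain ⟨d, rfl⟩ := Nat.exists_eq_add_of_le h
  rw [esc_add, Nat.add_sub_cancel_left, ENNReal.mul_inv (by simp) (by simp), mul_left_comm,
    ENNReal.mul_inv_cancel (esc_ne_zero hlam p) (esc_ne_top lam p), mul_one, ENNReal.inv_pow]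

lemma sum_energy_dil_le {m : 𝓢(V, ℂ)} {lam : ℝ} {B : ℝ≥0∞} {I : Finset ℕ}
    (hm : ∀ ξ, ∑ j ∈ I, ‖m ((sc lam j)⁻¹ • ξ)‖ₑ ^ 2 ≤ B) (f : 𝓢(V, ℂ)) :
    ∑ j ∈ I, energy (V := V) (dil m (sc lam j)⁻¹ f) ≤ B * energy (V := V) f := by
  simp_rw [← energy_ft (dil m _ f), ← energy_ft f, energy]
  rw [← lintegral_finsetSum _ fun j _ => (measurable_coe _).enorm.pow_const 2,
    ← lintegral_const_mul _ ((measurable_coe _).enorm.pow_const 2)]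
  refine lintegral_mono fun ξ => ?_
  simp_rw [ft_dil_apply, enorm_mul, mul_pow]
  rw [← Finset.sum_mul]
  gcongr
  exact hm ξ

/-- A Carleson type estimate: a low frequency function multiplied by the higher frequency pieces
of a bounded function. -/
lemma sum_energy_sprod_dil_le {m : 𝓢(V, ℂ)} {lam : ℝ} (hlam : 0 < lam) {B : ℝ≥0∞}
    (hm : ∀ (I : Finset ℕ) ξ, ∑ j ∈ I, ‖m ((sc lam j)⁻¹ • ξ)‖ₑ ^ 2 ≤ B)
    {a h : 𝓢(V, ℂ)} {H : ℝ≥0∞} (hH : H ≠ ∞) (hh : ∀ x, ‖h x‖ₑ ≤ H) {p : ℕ}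
    (ha : ∀ ξ, 16 * sc lam p < ‖ξ‖ → ft a ξ = 0) (I : Finset ℕ) :
    ∑ q ∈ I with p ≤ q, energy (V := V) (sprod a (dil m (sc lam q)⁻¹ h)) ≤
      2 * (B + kmom m 0 * kmom m 2 * ENNReal.ofReal (2 * Real.pi * 16) ^ 2 * 2) *
        (H ^ 2 * energy (V := V) a) := by
  set J := I.filter (p ≤ ·)
  have hcomm : ∀ q ∈ J, energy ⇑(dil m (sc lam q)⁻¹ (sprod a h) - sprod a (dil m (sc lam q)⁻¹ h))
      ≤ kmom m 0 * kmom m 2 * ENNReal.ofReal (2 * Real.pi * 16) ^ 2 *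
        (H ^ 2 * energy (V := V) a) * 2⁻¹ ^ (q - p) := by
    intro q hq
    have hpq : p ≤ q := (Finset.mem_filter.1 hq).2
    refine (energy_commutator_le_of_ft_eq_zero m _ hH
      (by have := sc_pos hlam p; positivity) ha hh).trans ?_
    have e1 : ENNReal.ofReal (2 * Real.pi * (16 * sc lam p)) * ‖(sc lam q)⁻¹‖ₑ =
        ENNReal.ofReal (2 * Real.pi * 16) * 2⁻¹ ^ (q - p) := by
      rw [← mul_assoc, ENNReal.ofReal_mul (by positivity), enorm_inv_sc hlam, mul_assoc,
        ← esc_mul_inv hlam hpq, esc, esc]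
    rw [e1]
    have e2 : ((2⁻¹ : ℝ≥0∞) ^ (q - p)) ^ 2 ≤ 2⁻¹ ^ (q - p) := by
      rw [sq]
      exact mul_le_of_le_one_left zero_le (pow_le_one' (by simp) _)
    calc _ = kmom m 0 * kmom m 2 * ENNReal.ofReal (2 * Real.pi * 16) ^ 2 *
        (H ^ 2 * energy (V := V) a) * (2⁻¹ ^ (q - p)) ^ 2 := by ring
      _ ≤ _ := by gcongr
  calc ∑ q ∈ J, energy (V := V) (sprod a (dil m (sc lam q)⁻¹ h))
      ≤ ∑ q ∈ J, 2 * (energy (V := V) (dil m (sc lam q)⁻¹ (sprod a h)) +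
        energy ⇑(dil m (sc lam q)⁻¹ (sprod a h) - sprod a (dil m (sc lam q)⁻¹ h))) := by
        refine Finset.sum_le_sum fun q _ => ?_
        refine le_of_eq_of_le ?_ (energy_sub_le (measurable_coe _))
        exact congrArg energy (funext fun x => by simp)
    _ ≤ ∑ q ∈ J, 2 * (energy (V := V) (dil m (sc lam q)⁻¹ (sprod a h)) +
        kmom m 0 * kmom m 2 * ENNReal.ofReal (2 * Real.pi * 16) ^ 2 *
        (H ^ 2 * energy (V := V) a) * 2⁻¹ ^ (q - p)) := by
        gcongr with q hq
        exact hcomm q hq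
    _ = 2 * (∑ q ∈ J, energy (V := V) (dil m (sc lam q)⁻¹ (sprod a h)) +
        kmom m 0 * kmom m 2 * ENNReal.ofReal (2 * Real.pi * 16) ^ 2 *
        (H ^ 2 * energy (V := V) a) * ∑ q ∈ J, 2⁻¹ ^ (q - p)) := by
        rw [← Finset.mul_sum, Finset.sum_add_distrib, ← Finset.mul_sum J]
    _ ≤ 2 * (B * (H ^ 2 * energy (V := V) a) +
        kmom m 0 * kmom m 2 * ENNReal.ofReal (2 * Real.pi * 16) ^ 2 *
        (H ^ 2 * energy (V := V) a) * 2) := by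
        gcongr
        · refine (sum_energy_dil_le (hm J) _).trans ?_
          gcongr
          exact energy_sprod_le_left hH hh
        · exact (sum_geometric_right_le _ I p).trans_eq one_sub_half_inv
    _ = _ := by ring

end Carleson

section Paraproducts

variable {V : Type*} [NormedAddCommGroup V] [InnerProductSpace ℝ V] [FiniteDimensional ℝ V]
  [MeasurableSpace V] [BorelSpace V]

lemma esc_rpow_le {lam : ℝ} (hlam : 0 < lam) {s : ℝ} (hs : 0 ≤ s) {p q : ℕ} (h : p ≤ q) :
    esc lam p ^ s = (2⁻¹ ^ s) ^ (q - p) * esc lam q ^ s := by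
  rw [← ENNReal.rpow_natCast, ← ENNReal.rpow_mul, mul_comm s, ENNReal.rpow_mul,
    ENNReal.rpow_natCast, ← ENNReal.mul_rpow_of_nonneg _ _ hs, ← esc_mul_inv hlam h, mul_assoc,
    ENNReal.inv_mul_cancel (esc_ne_zero hlam q) (esc_ne_top lam q), mul_one]

lemma esc_rpow_le_of_one_le {lam : ℝ} (hlam : 0 < lam) {s : ℝ} (hs : 1 ≤ s) {p q : ℕ}
    (h : p ≤ q) : esc lam p ^ s ≤ 2⁻¹ ^ (q - p) * esc lam q ^ s := by
  rw [esc_rpow_le hlam (by linarith) h]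
  gcongr
  calc (2⁻¹ : ℝ≥0∞) ^ s ≤ 2⁻¹ ^ (1 : ℝ) := ENNReal.rpow_le_rpow_of_exponent_ge (by simp) hs
    _ = _ := ENNReal.rpow_one _

omit [FiniteDimensional ℝ V] in
lemma measurable_wt (t : ℝ) (f : 𝓢(V, ℂ)) : Measurable (wt t f) := by
  unfold wt
  have := f.continuous.measurable
  fun_prop

omit [FiniteDimensional ℝ V] [MeasurableSpace V] [BorelSpace V] in
lemma sum_sprod_left {ι : Type*} (I : Finset ι) (a : ι → 𝓢(V, ℂ)) (b : 𝓢(V, ℂ)) :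
    sprod (∑ j ∈ I, a j) b = ∑ j ∈ I, sprod (a j) b := by
  simp [sprod]

omit [FiniteDimensional ℝ V] [MeasurableSpace V] [BorelSpace V] in
lemma sum_sprod_right {ι : Type*} (I : Finset ι) (a : 𝓢(V, ℂ)) (b : ι → 𝓢(V, ℂ)) :
    sprod a (∑ j ∈ I, b j) = ∑ j ∈ I, sprod a (b j) := by
  simp [sprod]

lemma energy_sum_wt_le {s : ℝ} (hs : 1 ≤ s) {lam : ℝ} (hlam : 0 < lam) {w : ℕ → 𝓢(V, ℂ)} {R : ℝ}
    (hR : 0 ≤ R) (hw : ∀ j ξ, R * sc lam j < ‖ξ‖ → ft (w j) ξ = 0) (I : Finset ℕ) :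
    energy (fun ξ => ∑ j ∈ I, wt s (ft (w j)) ξ) ≤
      8 * (ENNReal.ofReal R ^ s) ^ 2 * ∑ j ∈ I, (esc lam j ^ s) ^ 2 * energy (V := V) (w j) := by
  have hs0 : 0 ≤ s := by linarith
  have := energy_sum_le (fun j => measurable_wt s (ft (w j))) (I := I)
    (K := (ENNReal.ofReal R ^ s) ^ 2) (θ := 2⁻¹)
    (e := fun j => (esc lam j ^ s) ^ 2 * energy (V := V) (w j)) ?_
  · refine this.trans_eq ?_
    rw [one_sub_half_inv]
    ring
  · intro p _ q _ hpq
    simp_rw [← energy_ft (w _), energy]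
    have hm : ∀ j, Measurable fun ξ => ‖ft (w j) ξ‖ₑ ^ 2 := fun j =>
      (measurable_coe _).enorm.pow_const 2
    have hK : (ENNReal.ofReal R ^ s) ^ 2 * 2⁻¹ ^ (q - p) ≠ ∞ := by finiteness
    rw [← lintegral_const_mul _ (hm p), ← lintegral_const_mul _ (hm q),
      ← lintegral_add_left ((hm p).const_mul _), ← lintegral_const_mul' _ _ hK]
    refine lintegral_mono fun ξ => ?_
    rcases lt_or_ge (R * sc lam p) ‖ξ‖ with h | h
    · simp [wt, hw p ξ h]
    have hξ : ‖ξ‖ₑ ^ s ≤ ENNReal.ofReal R ^ s * esc lam p ^ s := by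
      rw [← ENNReal.mul_rpow_of_nonneg _ _ hs0, esc, ← ENNReal.ofReal_mul hR,
        ← ofReal_norm]
      gcongr
    set u := ‖ft (w p) ξ‖ₑ
    set v := ‖ft (w q) ξ‖ₑ
    rw [enorm_wt hs0, enorm_wt hs0]
    calc ‖ξ‖ₑ ^ s * u * (‖ξ‖ₑ ^ s * v)
        ≤ (ENNReal.ofReal R ^ s * esc lam p ^ s) * u *
          ((ENNReal.ofReal R ^ s * (2⁻¹ ^ (q - p) * esc lam q ^ s)) * v) := by
          gcongr
          exact hξ.trans (by gcongr; exact esc_rpow_le_of_one_le hlam hs hpq)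
      _ = (ENNReal.ofReal R ^ s) ^ 2 * 2⁻¹ ^ (q - p) *
          ((esc lam p ^ s * u) * (esc lam q ^ s * v)) := by ring
      _ ≤ (ENNReal.ofReal R ^ s) ^ 2 * 2⁻¹ ^ (q - p) *
          ((esc lam p ^ s * u) ^ 2 + (esc lam q ^ s * v) ^ 2) := by
          gcongr; exact mul_le_sq_add_sq _ _
      _ = _ := by simp only [mul_pow]

lemma ft_frac_eq_zero {s lam : ℝ} {n : ℕ} {u : 𝓢(V, ℂ)} {ξ : V} (h : ft u ξ = 0) :
    ft (frac s lam n u) ξ = 0 := by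
  rw [ft_frac_apply, ft_dil_apply, h, mul_zero, mul_zero]

lemma ft_sum_eq_zero {I : Finset ℕ} {u : ℕ → 𝓢(V, ℂ)} {ξ : V} (h : ∀ j ∈ I, ft (u j) ξ = 0) :
    ft (∑ j ∈ I, u j) ξ = 0 := by
  rw [map_sum, _root_.sum_apply]
  exact Finset.sum_eq_zero h

lemma ft_sprod_eq_zero_of_gt {a b : 𝓢(V, ℂ)} {R S : ℝ} (ha : ∀ ξ, R ≤ ‖ξ‖ → ft a ξ = 0)
    (hb : ∀ ξ, S ≤ ‖ξ‖ → ft b ξ = 0) {ξ : V} (h : R + S ≤ ‖ξ‖) : ft (sprod a b) ξ = 0 := by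
  refine ft_sprod_eq_zero fun η => ?_
  rcases le_or_gt R ‖η‖ with h1 | h1
  · exact Or.inl (ha _ h1)
  · refine Or.inr (hb _ ?_)
    have := norm_sub_norm_le ξ η
    linarith

lemma ft_sprod_eq_zero_of_lt {a b : 𝓢(V, ℂ)} {R S : ℝ} (ha : ∀ ξ, ‖ξ‖ ≤ R → ft a ξ = 0)
    (hb : ∀ ξ, S ≤ ‖ξ‖ → ft b ξ = 0) {ξ : V} (h : ‖ξ‖ ≤ R - S) : ft (sprod a b) ξ = 0 := by
  refine ft_sprod_eq_zero fun η => ?_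
  rcases le_or_gt ‖η‖ R with h1 | h1
  · exact Or.inl (ha _ h1)
  · refine Or.inr (hb _ ?_)
    have := norm_sub_norm_le η ξ
    rw [norm_sub_rev] at this
    linarith

omit [FiniteDimensional ℝ V] [MeasurableSpace V] [BorelSpace V] in
lemma sprod_comm (a b : 𝓢(V, ℂ)) : sprod a b = sprod b a := by
  ext x; simp [mul_comm]

lemma energy_sum_wt_sprod_le {s : ℝ} (hs : 1 ≤ s) {lam : ℝ} (hlam : 0 < lam) {f g : 𝓢(V, ℂ)}
    {G : ℝ≥0∞} (hG : G ≠ ∞) (hg : ∀ x, ‖g x‖ₑ ≤ G) (I : Finset ℕ) :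
    energy (fun ξ => ∑ j ∈ I,
      wt s (ft (sprod (pp lam j f) (∑ k ∈ Finset.range (j + 3), pp lam k g))) ξ) ≤
      8 * (ENNReal.ofReal 20 ^ s) ^ 2 * ((2 * kmom (phi (V := V)) 0) ^ 2 *
        (G ^ 2 * sob s f)) := by
  refine (energy_sum_wt_le hs hlam (R := 20) (by norm_num) (fun j ξ hξ => ?_) I).trans ?_
  · refine ft_sprod_eq_zero_of_gt (R := 4 * sc lam j) (S := 16 * sc lam j)
      (fun ξ h => ft_pp_eq_zero hlam (Or.inr h)) (fun ξ h => ft_sum_eq_zero fun k hk => ?_)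
      (by linarith)
    refine ft_pp_eq_zero hlam (Or.inr (le_trans ?_ h))
    have := sc_mono hlam (show k ≤ j + 2 by simp at hk; omega)
    rw [sc_add] at this
    linarith
  · gcongr
    calc _ ≤ ∑ j ∈ I, (esc lam j ^ s) ^ 2 *
          ((2 * kmom (phi (V := V)) 0 * G) ^ 2 * energy (V := V) (pp lam j f)) := by
          gcongr with j _
          refine energy_sprod_le_left ?_ fun x => ?_
          · exact ENNReal.mul_ne_top (ENNReal.mul_ne_top (by simp) (kmom_ne_top _ _)) hG
          · rw [Finset.range_eq_Ico]
            exact enorm_sum_pp_le hg _ _ x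
      _ = (2 * kmom (phi (V := V)) 0) ^ 2 * (G ^ 2 *
            ∑ j ∈ I, (esc lam j ^ s) ^ 2 * energy (V := V) (pp lam j f)) := by
          simp_rw [Finset.mul_sum]
          exact Finset.sum_congr rfl fun j _ => by ring
      _ ≤ _ := by
          gcongr
          exact sum_energy_pp_le (t := s) hlam (by linarith) I f

lemma enorm_sum_frac_le {s : ℝ} (hs : 1 ≤ s) {lam : ℝ} (hlam : 0 < lam) {g : 𝓢(V, ℂ)}
    {G : ℝ≥0∞} (hg : ∀ x, ‖g x‖ₑ ≤ G) (j : ℕ) (x : V) :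
    ‖(∑ k ∈ Finset.range (j - 2), frac s lam k (pp lam k g)) x‖ₑ ≤
      2 * kmom (rho (V := V) s) 0 * kmom (psi (V := V) 1 2) 0 * (esc lam j ^ s * G) := by
  rw [_root_.sum_apply]
  refine (enorm_sum_le _ _).trans ?_
  have hf : (Finset.range (j - 2)).filter (· ≤ j) = Finset.range (j - 2) :=
    Finset.filter_true_of_mem fun k hk => by simp at hk; omega
  calc _ ≤ ∑ k ∈ Finset.range (j - 2), 2⁻¹ ^ (j - k) * esc lam j ^ s *
        (kmom (rho (V := V) s) 0 * (kmom (psi (V := V) 1 2) 0 * G)) := by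
        refine Finset.sum_le_sum fun k hk => ?_
        refine (enorm_frac_le hlam (enorm_pp_le hg k) k x).trans ?_
        gcongr
        exact esc_rpow_le_of_one_le hlam hs (by simp at hk; omega)
    _ ≤ 2 * esc lam j ^ s * (kmom (rho (V := V) s) 0 * (kmom (psi (V := V) 1 2) 0 * G)) := by
        rw [← Finset.sum_mul, ← Finset.sum_mul, ← hf]
        gcongr
        exact (sum_geometric_left_le _ _ j).trans_eq one_sub_half_inv
    _ = _ := by ring

lemma energy_sum_ft_sprod_frac_le {s : ℝ} (hs : 1 ≤ s) {lam : ℝ} (hlam : 0 < lam)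
    {f g : 𝓢(V, ℂ)} {G : ℝ≥0∞} (hG : G ≠ ∞) (hg : ∀ x, ‖g x‖ₑ ≤ G) (I : Finset ℕ) :
    energy (fun ξ => ∑ j ∈ I,
      ft (sprod (pp lam j f) (∑ k ∈ Finset.range (j - 2), frac s lam k (pp lam k g))) ξ) ≤
      128 * (2 * kmom (rho (V := V) s) 0 * kmom (psi (V := V) 1 2) 0) ^ 2 *
        (G ^ 2 * sob s f) := by
  have hsupp : ∀ j ξ, ‖ξ‖ ≤ sc lam j / 2 ∨ 5 * sc lam j ≤ ‖ξ‖ →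
      ft (sprod (pp lam j f) (∑ k ∈ Finset.range (j - 2), frac s lam k (pp lam k g))) ξ = 0 := by
    intro j ξ hξ
    have hj := sc_pos hlam j
    have hlow : ∀ ξ : V, sc lam j / 2 ≤ ‖ξ‖ →
        ft (∑ k ∈ Finset.range (j - 2), frac s lam k (pp lam k g)) ξ = 0 := fun ξ h =>
      ft_sum_eq_zero fun k hk => ft_frac_eq_zero (ft_pp_eq_zero hlam (Or.inr (by
        have := sc_mono hlam (show k + 3 ≤ j by simp at hk; omega)
        rw [sc_add] at this
        linarith)))
    rcases hξ with h | h
    · exact ft_sprod_eq_zero_of_lt (fun ξ h => ft_pp_eq_zero hlam (Or.inl h)) hlow (by linarith)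
    · exact ft_sprod_eq_zero_of_gt (fun ξ h => ft_pp_eq_zero hlam (Or.inr h)) hlow (by linarith)
  refine (energy_sum_le_of_disjoint (fun j => measurable_coe _) fun p q hpq ξ => ?_).trans ?_
  · have h1 := sc_mono hlam hpq
    rw [sc_add] at h1
    have := sc_pos hlam p
    rcases le_total (5 * sc lam p) ‖ξ‖ with h | h
    · exact Or.inl (hsupp p ξ (Or.inr h))
    · exact Or.inr (hsupp q ξ (Or.inl (by linarith)))
  · rw [mul_assoc]
    gcongr
    set c := 2 * kmom (rho (V := V) s) 0 * kmom (psi (V := V) 1 2) 0 with hc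
    calc _ ≤ ∑ j ∈ I, (c * (esc lam j ^ s * G)) ^ 2 * energy (V := V) (pp lam j f) := by
          gcongr with j _
          rw [energy_ft]
          refine energy_sprod_le_left ?_ fun x => enorm_sum_frac_le hs hlam hg j x
          have := kmom_ne_top (rho (V := V) s) 0
          have := kmom_ne_top (psi (V := V) 1 2) 0
          have := esc_rpow_ne_top hlam j s
          finiteness
      _ = c ^ 2 * (G ^ 2 * ∑ j ∈ I, (esc lam j ^ s) ^ 2 * energy (V := V) (pp lam j f)) := by
          simp_rw [Finset.mul_sum]
          exact Finset.sum_congr rfl fun j _ => by ring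
      _ ≤ _ := by
          gcongr
          exact sum_energy_pp_le (t := s) hlam (by linarith) I f

lemma energy_frac_commutator_le {s lam : ℝ} (hlam : 0 < lam) {a h : 𝓢(V, ℂ)} {A : ℝ≥0∞}
    (hA : A ≠ ∞) (ha : Lip A a) (n : ℕ) :
    energy (fun x => frac s lam n (sprod a h) x - sprod a (frac s lam n h) x) ≤
      kmom (rho (V := V) s) 0 * kmom (rho (V := V) s) 2 *
        (A ^ 2 * ((esc lam n ^ (s - 1)) ^ 2 * energy (V := V) h)) := by
  have e1 : (fun x => frac s lam n (sprod a h) x - sprod a (frac s lam n h) x) =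
      fun x => ((sc lam n ^ s : ℝ) : ℂ) *
        (dil (rho s) (sc lam n)⁻¹ (sprod a h) - sprod a (dil (rho s) (sc lam n)⁻¹ h)) x := by
    funext x
    simp only [frac_apply, sprod_apply, _root_.sub_apply]
    ring
  rw [e1, energy_const_mul, enorm_sc_rpow hlam]
  calc _ ≤ (esc lam n ^ s) ^ 2 * (kmom (rho (V := V) s) 0 * kmom (rho (V := V) s) 2 *
        (‖(sc lam n)⁻¹‖ₑ ^ 2 * A ^ 2 * energy (V := V) h)) := by
        gcongr
        exact energy_commutator_le_of_lip _ _ hA ha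
    _ = kmom (rho (V := V) s) 0 * kmom (rho (V := V) s) 2 *
        (A ^ 2 * ((esc lam n ^ s * (esc lam n)⁻¹) ^ 2 * energy (V := V) h)) := by
        rw [enorm_inv_sc hlam]; ring
    _ = _ := by
        rw [ENNReal.rpow_sub _ _ (esc_ne_zero hlam n) (esc_ne_top lam n), ENNReal.rpow_one,
          div_eq_mul_inv]

lemma energy_sum_commutator_le {s : ℝ} (hs : 1 ≤ s) {lam : ℝ} (hlam : 0 < lam)
    {a : ℕ → 𝓢(V, ℂ)} {g : 𝓢(V, ℂ)} {A : ℝ≥0∞} (hA : A ≠ ∞) (ha : ∀ k, Lip A (a k))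
    (hsupp : ∀ k ξ, sc lam k / 2 ≤ ‖ξ‖ → ft (a k) ξ = 0) (I : Finset ℕ) :
    energy (fun ξ => ∑ k ∈ I, (wt s (ft (sprod (a k) (pp lam k g))) ξ -
        ft (sprod (a k) (frac s lam k (pp lam k g))) ξ)) ≤
      128 * (kmom (rho (V := V) s) 0 * kmom (rho (V := V) s) 2) *
        (A ^ 2 * sob (s - 1) g) := by
  have hz : ∀ k ξ, ‖ξ‖ ≤ sc lam k / 2 ∨ 5 * sc lam k ≤ ‖ξ‖ →
      ft (sprod (a k) (pp lam k g)) ξ = 0 := by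
    intro k ξ hξ
    have hj := sc_pos hlam k
    rw [sprod_comm]
    rcases hξ with h | h
    · exact ft_sprod_eq_zero_of_lt (fun ξ h => ft_pp_eq_zero hlam (Or.inl h)) (hsupp k)
        (by linarith)
    · exact ft_sprod_eq_zero_of_gt (fun ξ h => ft_pp_eq_zero hlam (Or.inr h)) (hsupp k)
        (by linarith)
  have hz' : ∀ k ξ, ‖ξ‖ ≤ sc lam k / 2 ∨ 5 * sc lam k ≤ ‖ξ‖ →
      ft (sprod (a k) (frac s lam k (pp lam k g))) ξ = 0 := by
    intro k ξ hξ
    have hj := sc_pos hlam k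
    rw [sprod_comm]
    rcases hξ with h | h
    · exact ft_sprod_eq_zero_of_lt (fun ξ h => ft_frac_eq_zero (ft_pp_eq_zero hlam (Or.inl h)))
        (hsupp k) (by linarith)
    · exact ft_sprod_eq_zero_of_gt (fun ξ h => ft_frac_eq_zero (ft_pp_eq_zero hlam (Or.inr h)))
        (hsupp k) (by linarith)
  have hD : ∀ k, (fun ξ => wt s (ft (sprod (a k) (pp lam k g))) ξ -
      ft (sprod (a k) (frac s lam k (pp lam k g))) ξ) =
      ft (frac s lam k (sprod (a k) (pp lam k g)) - sprod (a k) (frac s lam k (pp lam k g))) := by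
    intro k
    funext ξ
    rw [map_sub, _root_.sub_apply, ft_frac hlam fun ξ hξ => hz k ξ ?_]
    have hj := sc_pos hlam k
    rcases hξ with h | h
    · left; linarith
    · right; linarith
  refine (energy_sum_le_of_disjoint (D := fun k ξ => wt s (ft (sprod (a k) (pp lam k g))) ξ -
      ft (sprod (a k) (frac s lam k (pp lam k g))) ξ)
    (fun k => (measurable_wt _ _).sub (measurable_coe _)) fun p q hpq ξ => ?_).trans ?_
  · have h1 := sc_mono hlam hpq
    rw [sc_add] at h1
    have := sc_pos hlam p
    rcases le_total (5 * sc lam p) ‖ξ‖ with h | h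
    · exact Or.inl (by simp [wt, hz p ξ (Or.inr h), hz' p ξ (Or.inr h)])
    · have h' : ‖ξ‖ ≤ sc lam q / 2 := by linarith
      exact Or.inr (by simp [wt, hz q ξ (Or.inl h'), hz' q ξ (Or.inl h')])
  · rw [mul_assoc]
    gcongr
    calc _ ≤ ∑ k ∈ I, kmom (rho (V := V) s) 0 * kmom (rho (V := V) s) 2 *
        (A ^ 2 * ((esc lam k ^ (s - 1)) ^ 2 * energy (V := V) (pp lam k g))) := by
          gcongr with k _
          rw [hD, energy_ft]
          exact energy_frac_commutator_le hlam hA (ha k) k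
      _ = kmom (rho (V := V) s) 0 * kmom (rho (V := V) s) 2 *
        (A ^ 2 * ∑ k ∈ I, (esc lam k ^ (s - 1)) ^ 2 * energy (V := V) (pp lam k g)) := by
          simp_rw [Finset.mul_sum]
      _ ≤ _ := by
          gcongr
          exact sum_energy_pp_le (t := s - 1) hlam (by linarith) I g

end Paraproducts

section Remainder

variable {V : Type*} [NormedAddCommGroup V] [InnerProductSpace ℝ V] [FiniteDimensional ℝ V]
  [MeasurableSpace V] [BorelSpace V]

lemma inv_mul_energy_frac_ww_le {s lam : ℝ} (hs : 0 ≤ s) (hlam : 0 < lam) (n : ℕ) (g : 𝓢(V, ℂ)) :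
    ((esc lam n)⁻¹) ^ 2 * energy (V := V) (frac s lam n (ww lam n g)) ≤
      ENNReal.ofReal (32 ^ s) ^ 2 * ((esc lam n ^ (s - 1)) ^ 2 * energy (V := V) (ww lam n g)) := by
  calc _ ≤ ((esc lam n)⁻¹) ^ 2 * ((esc lam n ^ s) ^ 2 *
        (ENNReal.ofReal (32 ^ s) ^ 2 * energy (V := V) (ww lam n g))) := by
        gcongr
        exact energy_frac_le hlam hs n _
    _ = ENNReal.ofReal (32 ^ s) ^ 2 *
        ((esc lam n ^ s * (esc lam n)⁻¹) ^ 2 * energy (V := V) (ww lam n g)) := by ring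
    _ = _ := by
        rw [ENNReal.rpow_sub _ _ (esc_ne_zero hlam n) (esc_ne_top lam n), ENNReal.rpow_one,
          div_eq_mul_inv]

lemma energy_remainder_le_of_one_lt {s : ℝ} (hs : 1 < s) :
    ∃ C : ℝ≥0∞, C ≠ ∞ ∧ ∀ {lam : ℝ} (_ : 0 < lam) {f g : 𝓢(V, ℂ)} {A G : ℝ≥0∞} (_ : Lip A f)
      (_ : ∀ x, ‖g x‖ₑ ≤ G) (I : Finset ℕ),
      energy (fun x => ∑ j ∈ I, pp lam j f x * frac s lam j (ww lam j g) x) ≤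
        C * (A ^ 2 * sob (s - 1) g + G ^ 2 * sob s f) := by
  set θ : ℝ≥0∞ := 2⁻¹ ^ (s - 1) with hθ
  have hθ1 : θ < 1 := ENNReal.rpow_lt_one (by simp) (by linarith)
  set c1 := kmom (psi (V := V) 1 2) 1 with hc1
  set c2 := kmom (rho (V := V) s) 0 * kmom (psi (V := V) (1 / 4) 8) 0 with hc2
  set c3 : ℝ≥0∞ := ENNReal.ofReal (32 ^ s) ^ 2 * ((4 ^ (s - 1)) ^ 2 * 5) with hc3
  have hc1' : c1 ≠ ∞ := kmom_ne_top _ _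
  have hc2' : c2 ≠ ∞ := ENNReal.mul_ne_top (kmom_ne_top _ _) (kmom_ne_top _ _)
  have hc3' : c3 ≠ ∞ := by finiteness
  have hθ' : (1 - θ)⁻¹ ≠ ∞ := by
    rw [ENNReal.inv_ne_top]
    exact (tsub_pos_of_lt hθ1).ne'
  refine ⟨4 * (c1 * c2) * (1 - θ)⁻¹ * (c3 + 1), by finiteness, ?_⟩
  intro lam hlam f g A G hf hg I
  have key := energy_sum_le (D := fun j x => pp lam j f x * frac s lam j (ww lam j g) x)
    (fun j => (measurable_coe _).mul (measurable_coe _)) (K := c1 * c2) (θ := θ) (I := I)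
    (e := fun q => G ^ 2 * ((esc lam q ^ s) ^ 2 * energy (V := V) (pp lam q f)) +
      A ^ 2 * (((esc lam q)⁻¹) ^ 2 * energy (V := V) (frac s lam q (ww lam q g)))) ?_
  · refine key.trans ?_
    rw [mul_assoc (4 * (c1 * c2) * (1 - θ)⁻¹)]
    gcongr
    rw [Finset.sum_add_distrib, ← Finset.mul_sum, ← Finset.mul_sum]
    calc _ ≤ G ^ 2 * sob s f + A ^ 2 * (c3 * sob (s - 1) g) := by
          gcongr
          · exact sum_energy_pp_le hlam (by linarith) I f
          · calc _ ≤ ∑ q ∈ I, ENNReal.ofReal (32 ^ s) ^ 2 *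
                  ((esc lam q ^ (s - 1)) ^ 2 * energy (V := V) (ww lam q g)) := by
                  exact Finset.sum_le_sum fun q _ =>
                    inv_mul_energy_frac_ww_le (s := s) (by linarith) hlam q g
              _ ≤ _ := by
                  rw [← Finset.mul_sum, hc3, mul_assoc (ENNReal.ofReal _ ^ 2)]
                  gcongr
                  exact sum_energy_ww_le hlam (by linarith) I g
      _ ≤ c3 * (A ^ 2 * sob (s - 1) g) + 1 * (G ^ 2 * sob s f) := by
          rw [one_mul, add_comm]
          gcongr ?_ + _
          exact (mul_left_comm _ _ _).le
      _ ≤ (c3 + 1) * (A ^ 2 * sob (s - 1) g) + (c3 + 1) * (G ^ 2 * sob s f) := by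
          gcongr
          · exact le_self_add
          · exact le_add_self
      _ = _ := by ring
  · intro p _ q _ hpq
    have hm : ∀ u : 𝓢(V, ℂ), Measurable fun x => ‖u x‖ₑ ^ 2 := fun u =>
      (measurable_coe _).enorm.pow_const 2
    have hscale : esc lam p ^ s * (esc lam p)⁻¹ =
        θ ^ (q - p) * (esc lam q ^ s * (esc lam q)⁻¹) := by
      have := esc_rpow_le hlam (s := s - 1) (by linarith) hpq
      rwa [ENNReal.rpow_sub _ _ (esc_ne_zero hlam _) (esc_ne_top lam _), ENNReal.rpow_one,
        ENNReal.rpow_sub _ _ (esc_ne_zero hlam _) (esc_ne_top lam _), ENNReal.rpow_one,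
        div_eq_mul_inv, div_eq_mul_inv] at this
    calc ∫⁻ x, ‖pp lam p f x * frac s lam p (ww lam p g) x‖ₑ *
          ‖pp lam q f x * frac s lam q (ww lam q g) x‖ₑ
        ≤ ∫⁻ x, c1 * c2 * θ ^ (q - p) * (G ^ 2 * (esc lam q ^ s) ^ 2 * ‖pp lam q f x‖ₑ ^ 2 +
          A ^ 2 * ((esc lam q)⁻¹) ^ 2 * ‖frac s lam q (ww lam q g) x‖ₑ ^ 2) := by
          refine lintegral_mono fun x => ?_
          simp only [enorm_mul]
          have h1 := enorm_pp_le_of_lip hlam hf p x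
          have h2 := enorm_frac_le (s := s) hlam (enorm_ww_le (lam := lam) hg p) p x
          set u := ‖pp lam q f x‖ₑ
          set v := ‖frac s lam q (ww lam q g) x‖ₑ
          calc _ ≤ (c1 * ((esc lam p)⁻¹ * A)) * (esc lam p ^ s * (kmom (rho (V := V) s) 0 *
                (kmom (psi (V := V) (1 / 4) 8) 0 * G))) * (u * v) := by gcongr
            _ = c1 * c2 * (esc lam p ^ s * (esc lam p)⁻¹) * (A * G * (u * v)) := by
                rw [hc2]; ring
            _ = c1 * c2 * θ ^ (q - p) * ((G * esc lam q ^ s * u) * (A * (esc lam q)⁻¹ * v)) := by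
                rw [hscale]; ring
            _ ≤ c1 * c2 * θ ^ (q - p) *
                ((G * esc lam q ^ s * u) ^ 2 + (A * (esc lam q)⁻¹ * v) ^ 2) := by
                gcongr; exact mul_le_sq_add_sq _ _
            _ = _ := by simp only [mul_pow]
      _ = c1 * c2 * θ ^ (q - p) * (G ^ 2 * ((esc lam q ^ s) ^ 2 * energy (V := V) (pp lam q f)) +
          A ^ 2 * (((esc lam q)⁻¹) ^ 2 * energy (V := V) (frac s lam q (ww lam q g)))) := by
          have hθt : c1 * c2 * θ ^ (q - p) ≠ ∞ := by
            have := hθ1.ne_top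
            finiteness
          rw [lintegral_const_mul' _ _ hθt, lintegral_add_left ((hm _).const_mul _),
            lintegral_const_mul _ (hm _), lintegral_const_mul _ (hm _)]
          simp only [energy, mul_assoc]
      _ ≤ _ := by
          gcongr c1 * c2 * θ ^ (q - p) * ?_
          exact le_add_self

end Remainder

section Endpoint

open scoped LineDeriv

variable {V : Type*} [NormedAddCommGroup V] [InnerProductSpace ℝ V] [FiniteDimensional ℝ V]
  [MeasurableSpace V] [BorelSpace V]

omit [FiniteDimensional ℝ V] [MeasurableSpace V] [BorelSpace V] in
lemma Lip.enorm_lineDeriv_le {A : ℝ≥0∞} (hA : A ≠ ∞) {f : 𝓢(V, ℂ)} (hf : Lip A f) {v : V}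
    (hv : ‖v‖ = 1) (x : V) : ‖(∂_{v} f : 𝓢(V, ℂ)) x‖ₑ ≤ A := by
  have hL : LipschitzWith A.toNNReal f := fun x y => by
    rw [ENNReal.coe_toNNReal hA, edist_eq_enorm_sub, edist_eq_enorm_sub]
    exact hf x y
  have h1 : ‖fderiv ℝ f x‖ ≤ A.toNNReal := norm_fderiv_le_of_lipschitz ℝ hL
  rw [SchwartzMap.lineDerivOp_apply_eq_fderiv]
  have h2 := (fderiv ℝ f x).le_opNorm v
  rw [hv, mul_one] at h2
  rw [← ENNReal.coe_toNNReal hA]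
  exact enorm_le_coe.2 (h2.trans h1)

omit [FiniteDimensional ℝ V] [MeasurableSpace V] [BorelSpace V] in
lemma contDiffAt_riesz (v : V) (ξ : V) (h : ξ ≠ 0) : ContDiffAt ℝ (⊤ : ℕ∞)
    (fun ξ : V => ((inner ℝ ξ v / ‖ξ‖ ^ 2 : ℝ) : ℂ) * (2 * Real.pi * Complex.I)⁻¹) ξ := by
  refine ContDiffAt.mul (Complex.ofRealCLM.contDiff.contDiffAt.comp ξ ?_) contDiffAt_const
  refine ContDiffAt.div (contDiffAt_id.inner ℝ contDiffAt_const)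
    (contDiffAt_id.norm_sq ℝ) ?_
  simpa using h

/-- The Riesz type multiplier `⟪ξ, v⟫ / (2 π i ‖ξ‖ ^ 2)` localised to an annulus. -/
noncomputable def riesz (v : V) : 𝓢(V, ℂ) :=
  symb (fun ξ => ((inner ℝ ξ v / ‖ξ‖ ^ 2 : ℝ) : ℂ) * (2 * Real.pi * Complex.I)⁻¹) 1 2

omit [MeasurableSpace V] [BorelSpace V] in
lemma riesz_apply (v ξ : V) : riesz v ξ =
    ((inner ℝ ξ v / ‖ξ‖ ^ 2 : ℝ) : ℂ) * (2 * Real.pi * Complex.I)⁻¹ * (cut 1 2 ξ : ℂ) :=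
  symb_apply (contDiffAt_riesz v) one_pos one_le_two ξ

omit [MeasurableSpace V] [BorelSpace V] in
lemma enorm_riesz_le {v : V} (hv : ‖v‖ = 1) (ξ : V) : ‖riesz v ξ‖ₑ ≤ ‖psi (V := V) 1 2 ξ‖ₑ := by
  rw [riesz_apply, psi_apply one_pos one_le_two]
  rcases le_total ‖ξ‖ 1 with h | h
  · simp [cut_eq_zero_of_le one_pos one_le_two h]
  · rw [enorm_mul]
    refine mul_le_of_le_one_left zero_le ?_
    rw [← ofReal_norm, ENNReal.ofReal_le_one, norm_mul, norm_inv, Complex.norm_real]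
    have h1 : ‖inner ℝ ξ v / ‖ξ‖ ^ 2‖ ≤ 1 := by
      rw [norm_div, norm_pow, norm_norm]
      have := norm_inner_le_norm (𝕜 := ℝ) ξ v
      rw [hv, mul_one] at this
      rw [div_le_one (by positivity)]
      nlinarith
    have h2 : ‖(2 * Real.pi * Complex.I : ℂ)‖⁻¹ ≤ 1 := by
      simp only [norm_mul, Complex.norm_real, Complex.norm_I, mul_one]
      rw [Real.norm_of_nonneg Real.pi_pos.le]
      refine inv_le_one_of_one_le₀ ?_
      have := Real.pi_gt_three
      norm_num
      linarith
    exact mul_le_one₀ h1 (by positivity) h2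

omit [MeasurableSpace V] [BorelSpace V] in
lemma sum_riesz_sq_le (lam : ℝ) {v : V} (hv : ‖v‖ = 1) (I : Finset ℕ) (ξ : V) :
    ∑ j ∈ I, ‖riesz v ((sc lam j)⁻¹ • ξ)‖ₑ ^ 2 ≤ 1 := by
  refine le_trans ?_ ((sum_psi_sq_le (d := 1) (b := 2) lam one_pos le_rfl (by norm_num) I
    ξ).trans_eq Nat.cast_one)
  gcongr with j _
  exact enorm_riesz_le hv _

lemma ft_lineDeriv_apply (f : 𝓢(V, ℂ)) (v ξ : V) :
    ft (∂_{v} f : 𝓢(V, ℂ)) ξ = 2 * Real.pi * Complex.I * ((inner ℝ ξ v : ℝ) * ft f ξ) := by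
  change 𝓕 (∂_{v} f : 𝓢(V, ℂ)) ξ = _
  have : (inner ℝ · v).HasTemperateGrowth := ((innerSL ℝ).flip v).hasTemperateGrowth
  rw [SchwartzMap.fourier_lineDerivOp_eq, smul_apply, SchwartzMap.smulLeftCLM_apply_apply this]
  rfl

lemma smul_pp_eq_sum {lam : ℝ} (hlam : 0 < lam) {ι : Type*} [Fintype ι]
    (b : OrthonormalBasis ι ℝ V) (n : ℕ) (f : 𝓢(V, ℂ)) :
    (sc lam n : ℂ) • pp lam n f = ∑ i, dil (riesz (b i)) (sc lam n)⁻¹ (∂_{b i} f : 𝓢(V, ℂ)) := by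
  refine eq_of_ft_eq fun ξ => ?_
  have hsc := (sc_pos hlam n).ne'
  rw [map_sum, _root_.sum_apply, map_smul, smul_apply, pp, ft_dil_apply,
    psi_apply one_pos one_le_two]
  simp_rw [ft_dil_apply, ft_lineDeriv_apply, riesz_apply]
  rcases eq_or_ne ξ 0 with rfl | hξ
  · simp [cut_eq_zero_of_le one_pos one_le_two (show ‖(0 : V)‖ ≤ 1 by simp)]
  have hξ' : ‖ξ‖ ≠ 0 := norm_ne_zero_iff.2 hξ
  have h1 : ∀ i, ((inner ℝ ((sc lam n)⁻¹ • ξ) (b i) / ‖(sc lam n)⁻¹ • ξ‖ ^ 2 : ℝ) : ℂ) *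
      (2 * Real.pi * Complex.I)⁻¹ * (cut 1 2 ((sc lam n)⁻¹ • ξ) : ℂ) *
      (2 * Real.pi * Complex.I * ((inner ℝ ξ (b i) : ℝ) * ft f ξ)) =
      (((inner ℝ ξ (b i)) ^ 2 : ℝ) : ℂ) * ((sc lam n / ‖ξ‖ ^ 2 : ℝ) *
        ((cut 1 2 ((sc lam n)⁻¹ • ξ) : ℂ) * ft f ξ)) := by
    intro i
    have h2 : inner ℝ ((sc lam n)⁻¹ • ξ) (b i) / ‖(sc lam n)⁻¹ • ξ‖ ^ 2 =
        sc lam n / ‖ξ‖ ^ 2 * inner ℝ ξ (b i) := by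
      rw [real_inner_smul_left, norm_smul, norm_inv, mul_pow, Real.norm_eq_abs, inv_pow, sq_abs]
      field_simp
    rw [h2]
    have hπ : (2 * Real.pi * Complex.I : ℂ) ≠ 0 := Complex.two_pi_I_ne_zero
    set P := (2 * Real.pi * Complex.I : ℂ)
    push_cast
    field_simp
  simp_rw [h1]
  rw [← Finset.sum_mul, ← Complex.ofReal_sum, b.sum_sq_inner_left ξ, smul_eq_mul,
    ← mul_assoc ((‖ξ‖ ^ 2 : ℝ) : ℂ), ← Complex.ofReal_mul, mul_div_cancel₀ _ (by positivity)]

lemma energy_fintype_sum_le {ι : Type*} [Fintype ι] (u : ι → 𝓢(V, ℂ)) :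
    energy ⇑(∑ i, u i) ≤ Fintype.card ι * ∑ i, energy ⇑(u i) := by
  simp only [energy]
  rw [← lintegral_finsetSum _ fun i _ => (measurable_coe _).enorm.pow_const 2,
    ← lintegral_const_mul' _ _ (by simp)]
  refine lintegral_mono fun x => ?_
  rw [_root_.sum_apply]
  have := ENNReal.rpow_sum_le_const_mul_sum_rpow Finset.univ (fun i => ‖u i x‖ₑ) one_le_two
  norm_num at this
  exact le_trans (by gcongr; exact enorm_sum_le _ _) this

lemma frac_ww_eq (s lam : ℝ) (n : ℕ) (g : 𝓢(V, ℂ)) :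
    frac s lam n (ww lam n g) = ((sc lam n ^ s : ℝ) : ℂ) •
      dil (sprod (rho s) (psi (1 / 4) 8)) (sc lam n)⁻¹ g := by
  refine eq_of_ft_eq fun ξ => ?_
  rw [map_smul, smul_apply, ft_frac_apply, ft_dil_apply, ft_dil_apply, sprod_apply, ww,
    ft_dil_apply, smul_eq_mul, mul_assoc]

lemma energy_smul (c : ℂ) (u : 𝓢(V, ℂ)) : energy ⇑(c • u) = ‖c‖ₑ ^ 2 * energy (V := V) u :=
  energy_const_mul c u

lemma enorm_mul_mul_mul_le (a b c d : ℂ) :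
    ‖a * b‖ₑ * ‖c * d‖ₑ ≤ ‖a * d‖ₑ ^ 2 + ‖b * c‖ₑ ^ 2 := by
  refine le_trans (le_of_eq ?_) (mul_le_sq_add_sq _ _)
  simp only [enorm_mul]
  ring

/-- The multiplier producing the normalised high frequency pieces `sc⁻¹ Λ (ww g)`. -/
noncomputable def lsym : 𝓢(V, ℂ) := sprod (rho 1) (psi (1 / 4) 8)

omit [MeasurableSpace V] [BorelSpace V] in
lemma sum_lsym_sq_le (lam : ℝ) (I : Finset ℕ) (ξ : V) :
    ∑ j ∈ I, ‖lsym ((sc lam j)⁻¹ • ξ)‖ₑ ^ 2 ≤ ENNReal.ofReal (32 ^ (1 : ℝ)) ^ 2 * 5 := by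
  calc _ ≤ ∑ j ∈ I, ENNReal.ofReal (32 ^ (1 : ℝ)) ^ 2 *
        ‖psi (V := V) (1 / 4) 8 ((sc lam j)⁻¹ • ξ)‖ₑ ^ 2 := by
        refine Finset.sum_le_sum fun j _ => ?_
        rw [lsym, sprod_apply, enorm_mul, mul_pow]
        gcongr
        exact enorm_rho_le zero_le_one _
    _ ≤ _ := by
        rw [← Finset.mul_sum]
        gcongr
        exact sum_psi_sq_le (d := 5) lam (by norm_num) (by norm_num) (by norm_num) I ξ

lemma energy_remainder_le_one :
    ∃ C : ℝ≥0∞, C ≠ ∞ ∧ ∀ {lam : ℝ} (_ : 0 < lam) {f g : 𝓢(V, ℂ)} {A G : ℝ≥0∞} (_ : A ≠ ∞)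
      (_ : G ≠ ∞) (_ : Lip A f) (_ : ∀ x, ‖g x‖ₑ ≤ G) (I : Finset ℕ),
      energy (fun x => ∑ j ∈ I, pp lam j f x * frac 1 lam j (ww lam j g) x) ≤
        C * (A ^ 2 * sob (1 - 1) g + G ^ 2 * sob 1 f) := by
  set b := stdOrthonormalBasis ℝ V
  set c0 : ℝ≥0∞ := ENNReal.ofReal (32 ^ (1 : ℝ)) with hc0
  set c1 : ℝ≥0∞ := 2 * (c0 ^ 2 * 5 + kmom (lsym (V := V)) 0 * kmom (lsym (V := V)) 2 *
    ENNReal.ofReal (2 * Real.pi * 16) ^ 2 * 2) with hc1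
  set d : Fin (Module.finrank ℝ V) → ℝ≥0∞ := fun i => 2 * (1 + kmom (riesz (b i)) 0 *
    kmom (riesz (b i)) 2 * ENNReal.ofReal (2 * Real.pi * 16) ^ 2 * 2) with hd
  set c2 : ℝ≥0∞ := (Fintype.card (Fin (Module.finrank ℝ V)) : ℝ≥0∞) * ∑ i, d i with hc2
  set c3 : ℝ≥0∞ := c0 ^ 2 * ((4 ^ (1 - 1 : ℝ)) ^ 2 * 5) with hc3
  have hc1' : c1 ≠ ∞ := by
    have := kmom_ne_top (lsym (V := V)) 0
    have := kmom_ne_top (lsym (V := V)) 2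
    finiteness
  have hc2' : c2 ≠ ∞ := by
    refine ENNReal.mul_ne_top (by simp) (ENNReal.sum_ne_top.2 fun i _ => ?_)
    have := kmom_ne_top (riesz (b i)) 0
    have := kmom_ne_top (riesz (b i)) 2
    finiteness
  have hc3' : c3 ≠ ∞ := by finiteness
  refine ⟨2 * (c1 + c2 * c3), by finiteness, ?_⟩
  intro lam hlam f g A G hA hG hf hg I
  set F : ℕ → 𝓢(V, ℂ) := fun j => (sc lam j : ℂ) • pp lam j f with hF
  set L : ℕ → 𝓢(V, ℂ) := fun j => dil lsym (sc lam j)⁻¹ g with hL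
  have hFL : ∀ j x, pp lam j f x * frac 1 lam j (ww lam j g) x = F j x * L j x := by
    intro j x
    rw [frac_ww_eq, Real.rpow_one]
    simp only [hF, hL, lsym, smul_apply, smul_eq_mul]
    ring
  have hFsupp : ∀ p ξ, 16 * sc lam p < ‖ξ‖ → ft (F p) ξ = 0 := by
    intro p ξ h
    have := sc_pos hlam p
    rw [hF, map_smul, smul_apply, ft_pp_eq_zero hlam (Or.inr (by linarith)), smul_zero]
  have hLeq : ∀ p, L p = ((sc lam p ^ (1 : ℝ) : ℝ) : ℂ)⁻¹ • frac 1 lam p (ww lam p g) := by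
    intro p
    have : ((sc lam p ^ (1 : ℝ) : ℝ) : ℂ) ≠ 0 := by
      have := sc_pos hlam p
      exact_mod_cast (by positivity)
    rw [frac_ww_eq, inv_smul_smul₀ this]
    rfl
  have hLsupp : ∀ p ξ, 16 * sc lam p < ‖ξ‖ → ft (L p) ξ = 0 := by
    intro p ξ h
    rw [hLeq, map_smul, smul_apply, ft_frac_eq_zero (ft_ww_eq_zero hlam (Or.inr h.le)), smul_zero]
  have hFe : ∑ p ∈ I, energy ⇑(F p) ≤ sob 1 f := by
    refine le_of_eq_of_le (Finset.sum_congr rfl fun p _ => ?_)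
      (sum_energy_pp_le (t := 1) hlam zero_le_one I f)
    rw [hF, energy_smul, ENNReal.rpow_one, ← enorm_sc hlam, ← ofReal_norm, ← ofReal_norm,
      Complex.norm_real]
  have hLe : ∑ p ∈ I, energy ⇑(L p) ≤ c3 * sob (1 - 1) g := by
    calc _ ≤ ∑ p ∈ I, c0 ^ 2 * ((esc lam p ^ (1 - 1 : ℝ)) ^ 2 * energy (V := V) (ww lam p g)) := by
          refine Finset.sum_le_sum fun p _ => ?_
          rw [hLeq, energy_smul]
          refine le_trans (le_of_eq ?_)
            (inv_mul_energy_frac_ww_le (s := 1) zero_le_one hlam p g)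
          rw [enorm_inv (by
            have := sc_pos hlam p
            exact_mod_cast (by positivity)), enorm_sc_rpow hlam, ENNReal.rpow_one]
      _ ≤ _ := by
          rw [← Finset.mul_sum, hc3, mul_assoc (c0 ^ 2)]
          gcongr
          exact sum_energy_ww_le (t := 1 - 1) hlam (by norm_num) I g
  have hm : ∀ u : 𝓢(V, ℂ), Measurable fun x => ‖u x‖ₑ ^ 2 := fun u =>
    (measurable_coe _).enorm.pow_const 2
  simp_rw [hFL]
  refine (energy_sum_le_sum_lintegral (fun j => (measurable_coe (F j)).mul (measurable_coe (L j)))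
    I).trans ?_
  calc _ ≤ 2 * ∑ p ∈ I, ∑ q ∈ I with p ≤ q,
        (energy ⇑(sprod (F p) (L q)) + energy ⇑(sprod (L p) (F q))) := by
        refine mul_le_mul_right (Finset.sum_le_sum fun p _ => Finset.sum_le_sum fun q _ => ?_) 2
        rw [energy, energy, ← lintegral_add_left (hm _)]
        refine lintegral_mono fun x => ?_
        rw [sprod_apply, sprod_apply]
        exact enorm_mul_mul_mul_le (F p x) (L p x) (F q x) (L q x)
    _ ≤ 2 * ∑ p ∈ I, (c1 * (G ^ 2 * energy ⇑(F p)) + c2 * (A ^ 2 * energy ⇑(L p))) := by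
        gcongr with p _
        rw [Finset.sum_add_distrib]
        gcongr
        · exact sum_energy_sprod_dil_le hlam (sum_lsym_sq_le lam) hG hg (hFsupp p) I
        · calc _ ≤ ∑ q ∈ I with p ≤ q, (Fintype.card (Fin (Module.finrank ℝ V)) : ℝ≥0∞) *
                ∑ i, energy ⇑(sprod (L p) (dil (riesz (b i)) (sc lam q)⁻¹
                  (∂_{b i} f : 𝓢(V, ℂ)))) := by
                refine Finset.sum_le_sum fun q _ => ?_
                simp only [hF]
                rw [smul_pp_eq_sum hlam b, sum_sprod_right]
                exact energy_fintype_sum_le _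
            _ = (Fintype.card (Fin (Module.finrank ℝ V)) : ℝ≥0∞) *
                ∑ i, ∑ q ∈ I with p ≤ q, energy ⇑(sprod (L p) (dil (riesz (b i)) (sc lam q)⁻¹
                  (∂_{b i} f : 𝓢(V, ℂ)))) := by
                rw [← Finset.mul_sum, Finset.sum_comm]
            _ ≤ (Fintype.card (Fin (Module.finrank ℝ V)) : ℝ≥0∞) *
                ∑ i, d i * (A ^ 2 * energy ⇑(L p)) := by
                gcongr with i _
                exact sum_energy_sprod_dil_le hlam (sum_riesz_sq_le lam (b.orthonormal.1 i)) hA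
                  (hf.enorm_lineDeriv_le hA (b.orthonormal.1 i)) (hLsupp p) I
            _ = _ := by rw [← Finset.sum_mul, mul_assoc]
    _ = 2 * (c1 * (G ^ 2 * ∑ p ∈ I, energy ⇑(F p)) + c2 * (A ^ 2 * ∑ p ∈ I, energy ⇑(L p))) := by
        simp_rw [Finset.sum_add_distrib, Finset.mul_sum]
    _ ≤ 2 * (c1 * (G ^ 2 * sob 1 f) + c2 * (A ^ 2 * (c3 * sob (1 - 1) g))) := by gcongr
    _ = 2 * (c1 * (G ^ 2 * sob 1 f) + (c2 * c3) * (A ^ 2 * sob (1 - 1) g)) := by ring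
    _ ≤ 2 * ((c1 + c2 * c3) * (G ^ 2 * sob 1 f) + (c1 + c2 * c3) * (A ^ 2 * sob (1 - 1) g)) := by
        gcongr
        · exact le_self_add
        · exact le_add_self
    _ = _ := by ring

lemma energy_remainder_le {s : ℝ} (hs : 1 ≤ s) :
    ∃ C : ℝ≥0∞, C ≠ ∞ ∧ ∀ {lam : ℝ} (_ : 0 < lam) {f g : 𝓢(V, ℂ)} {A G : ℝ≥0∞} (_ : A ≠ ∞)
      (_ : G ≠ ∞) (_ : Lip A f) (_ : ∀ x, ‖g x‖ₑ ≤ G) (I : Finset ℕ),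
      energy (fun x => ∑ j ∈ I, pp lam j f x * frac s lam j (ww lam j g) x) ≤
        C * (A ^ 2 * sob (s - 1) g + G ^ 2 * sob s f) := by
  rcases hs.eq_or_lt with rfl | hs
  · exact energy_remainder_le_one
  · obtain ⟨C, hC, h⟩ := energy_remainder_le_of_one_lt (V := V) hs
    exact ⟨C, hC, fun hlam _ _ _ _ _ _ hf hg I => h hlam hf hg I⟩

end Endpoint

section Assembly

lemma sum_Ico_sum_range_eq {X : Type*} [AddCommMonoid X] (W : ℕ → ℕ → X) (M : ℕ) :
    ∑ j ∈ Finset.Ico 2 (M + 2), ∑ k ∈ Finset.range (M + 5), W j k =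
      ∑ j ∈ Finset.Ico 2 (M + 2), ∑ k ∈ Finset.range (j + 3), W j k +
        ∑ k ∈ Finset.range (M + 5), ∑ j ∈ Finset.Ico 2 (min (M + 2) (k - 2)), W j k := by
  have h : ∑ k ∈ Finset.range (M + 5), ∑ j ∈ Finset.Ico 2 (min (M + 2) (k - 2)), W j k =
      ∑ j ∈ Finset.Ico 2 (M + 2), ∑ k ∈ Finset.Ico (j + 3) (M + 5), W j k := by
    refine Finset.sum_comm' fun k j => ?_
    simp only [Finset.mem_range, Finset.mem_Ico, lt_min_iff]
    omega
  rw [h, ← Finset.sum_add_distrib]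
  refine Finset.sum_congr rfl fun j hj => ?_
  rw [Finset.mem_Ico] at hj
  exact (Finset.sum_range_add_sum_Ico _ (by omega)).symm

variable {V : Type*} [NormedAddCommGroup V] [InnerProductSpace ℝ V] [FiniteDimensional ℝ V]
  [MeasurableSpace V] [BorelSpace V]

lemma wt_ft_add (s : ℝ) (u v : 𝓢(V, ℂ)) (ξ : V) :
    wt s (ft (u + v)) ξ = wt s (ft u) ξ + wt s (ft v) ξ := by
  simp [wt, mul_add]

lemma wt_ft_sum (s : ℝ) (I : Finset ℕ) (u : ℕ → 𝓢(V, ℂ)) (ξ : V) :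
    wt s (ft (∑ j ∈ I, u j)) ξ = ∑ j ∈ I, wt s (ft (u j)) ξ := by
  simp [wt, Finset.mul_sum]

lemma sum_frac_pp_eq (s : ℝ) {lam : ℝ} (hlam : 0 < lam) {j : ℕ} (hj : 2 ≤ j) (g : 𝓢(V, ℂ)) :
    ∑ k ∈ Finset.Ico (j - 2) (j + 3), frac s lam k (pp lam k g) =
      frac s lam j (ww lam j g) := by
  obtain ⟨n, rfl⟩ := Nat.exists_eq_add_of_le' hj
  refine eq_of_ft_eq fun ξ => ?_
  rw [ft_frac hlam fun ξ h => ft_ww_eq_zero hlam (h.imp le_of_lt le_of_lt), ww_eq_sum, wt_ft_sum,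
    map_sum, _root_.sum_apply, Nat.add_sub_cancel]
  refine Finset.sum_congr rfl fun k _ => ft_frac hlam (fun ξ h => ft_pp_eq_zero hlam ?_) ξ
  have := sc_pos hlam k
  rcases h with h | h
  · left; linarith
  · right; linarith

/-- The frequency truncation of `f` used in the paraproduct decomposition. -/
noncomputable def lowSum (lam : ℝ) (M : ℕ) (f : 𝓢(V, ℂ)) : 𝓢(V, ℂ) :=
  ∑ j ∈ Finset.Ico 2 (M + 2), pp lam j f

/-- The frequency truncation of `g` used in the paraproduct decomposition. -/
noncomputable def highSum (lam : ℝ) (M : ℕ) (g : 𝓢(V, ℂ)) : 𝓢(V, ℂ) :=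
  ∑ k ∈ Finset.range (M + 5), pp lam k g

/-- `Λ^s` applied to `highSum`. -/
noncomputable def fracSum (s lam : ℝ) (M : ℕ) (g : 𝓢(V, ℂ)) : 𝓢(V, ℂ) :=
  ∑ k ∈ Finset.range (M + 5), frac s lam k (pp lam k g)

lemma sprod_low_eq (lam : ℝ) (M : ℕ) (f : 𝓢(V, ℂ)) (b : ℕ → 𝓢(V, ℂ)) :
    sprod (lowSum lam M f) (∑ k ∈ Finset.range (M + 5), b k) =
      ∑ j ∈ Finset.Ico 2 (M + 2), sprod (pp lam j f) (∑ k ∈ Finset.range (j + 3), b k) +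
        ∑ k ∈ Finset.range (M + 5),
          sprod (∑ j ∈ Finset.Ico 2 (min (M + 2) (k - 2)), pp lam j f) (b k) := by
  simp_rw [lowSum, sum_sprod_left, sum_sprod_right]
  exact sum_Ico_sum_range_eq (fun j k => sprod (pp lam j f) (b k)) M

lemma truncated_commutator_eq (s : ℝ) {lam : ℝ} (hlam : 0 < lam) (M : ℕ) (f g : 𝓢(V, ℂ)) (ξ : V) :
    wt s (ft (sprod (lowSum lam M f) (highSum lam M g))) ξ -
        ft (sprod (lowSum lam M f) (fracSum s lam M g)) ξ =
      (∑ k ∈ Finset.range (M + 5),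
        (wt s (ft (sprod (∑ j ∈ Finset.Ico 2 (min (M + 2) (k - 2)), pp lam j f)
            (pp lam k g))) ξ -
          ft (sprod (∑ j ∈ Finset.Ico 2 (min (M + 2) (k - 2)), pp lam j f)
            (frac s lam k (pp lam k g))) ξ) +
      ∑ j ∈ Finset.Ico 2 (M + 2),
        wt s (ft (sprod (pp lam j f) (∑ k ∈ Finset.range (j + 3), pp lam k g))) ξ) -
      (∑ j ∈ Finset.Ico 2 (M + 2),
        ft (sprod (pp lam j f) (∑ k ∈ Finset.range (j - 2), frac s lam k (pp lam k g))) ξ +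
      ft (∑ j ∈ Finset.Ico 2 (M + 2), sprod (pp lam j f) (frac s lam j (ww lam j g))) ξ) := by
  have h : ∑ j ∈ Finset.Ico 2 (M + 2),
      sprod (pp lam j f) (∑ k ∈ Finset.range (j + 3), frac s lam k (pp lam k g)) =
      ∑ j ∈ Finset.Ico 2 (M + 2),
        sprod (pp lam j f) (∑ k ∈ Finset.range (j - 2), frac s lam k (pp lam k g)) +
      ∑ j ∈ Finset.Ico 2 (M + 2), sprod (pp lam j f) (frac s lam j (ww lam j g)) := by
    rw [← Finset.sum_add_distrib]
    refine Finset.sum_congr rfl fun j hj => ?_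
    rw [← Finset.sum_range_add_sum_Ico _ (show j - 2 ≤ j + 3 by omega),
      sum_frac_pp_eq s hlam (Finset.mem_Ico.1 hj).1]
    simp [sprod]
  rw [highSum, fracSum, sprod_low_eq, sprod_low_eq, h, wt_ft_add, wt_ft_sum, wt_ft_sum]
  simp only [map_add, map_sum, _root_.add_apply, _root_.sum_apply, Finset.sum_sub_distrib]
  ring

lemma energy_truncated_commutator_le {s : ℝ} (hs : 1 ≤ s) :
    ∃ C : ℝ≥0∞, C ≠ ∞ ∧ ∀ {lam : ℝ} (_ : 0 < lam) {f g : 𝓢(V, ℂ)} {A G : ℝ≥0∞} (_ : A ≠ ∞)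
      (_ : G ≠ ∞) (_ : Lip A f) (_ : ∀ x, ‖g x‖ₑ ≤ G) (M : ℕ),
      energy (fun ξ => wt s (ft (sprod (lowSum lam M f) (highSum lam M g))) ξ -
        ft (sprod (lowSum lam M f) (fracSum s lam M g)) ξ) ≤
        C * (A ^ 2 * sob (s - 1) g + G ^ 2 * sob s f) := by
  obtain ⟨C4, hC4, h4⟩ := energy_remainder_le (V := V) hs
  set k0 := kmom (phi (V := V)) 0 with hk0
  have hk0' : k0 ≠ ∞ := kmom_ne_top _ _
  have hr0 := kmom_ne_top (rho (V := V) s) 0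
  have hr2 := kmom_ne_top (rho (V := V) s) 2
  have hp0 := kmom_ne_top (psi (V := V) 1 2) 0
  set C1 := 128 * (kmom (rho (V := V) s) 0 * kmom (rho (V := V) s) 2) * (2 * k0) ^ 2 with hC1
  set C2 := 8 * (ENNReal.ofReal 20 ^ s) ^ 2 * (2 * k0) ^ 2 with hC2
  set C3 := 128 * (2 * kmom (rho (V := V) s) 0 * kmom (psi (V := V) 1 2) 0) ^ 2 with hC3
  have hs0 : 0 ≤ s := by linarith
  refine ⟨2 * (2 * (C1 + C2) + 2 * (C3 + C4)), by finiteness, ?_⟩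
  intro lam hlam f g A G hA hG hf hg M
  simp_rw [truncated_commutator_eq s hlam]
  set X := A ^ 2 * sob (s - 1) g + G ^ 2 * sob s f with hX
  have hXa : A ^ 2 * sob (s - 1) g ≤ X := le_self_add
  have hXg : G ^ 2 * sob s f ≤ X := le_add_self
  have e1 : energy _ ≤ C1 * X := (energy_sum_commutator_le hs hlam (A := 2 * k0 * A) (g := g)
    (a := fun k => ∑ j ∈ Finset.Ico 2 (min (M + 2) (k - 2)), pp lam j f) (by finiteness)
    (fun k => lip_sum_pp hf _ _) (fun k ξ hξ => ft_sum_eq_zero fun j hj => by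
      rw [Finset.mem_Ico, lt_min_iff] at hj
      have := sc_mono hlam (show j + 3 ≤ k by omega)
      rw [sc_add] at this
      exact ft_pp_eq_zero hlam (Or.inr (by linarith))) (Finset.range (M + 5))).trans (by
        rw [hC1, mul_pow _ A, mul_assoc _ (A ^ 2), ← mul_assoc _ _ (A ^ 2 * _)]
        gcongr)
  have e2 : energy _ ≤ C2 * X := (energy_sum_wt_sprod_le hs hlam hG hg
    (Finset.Ico 2 (M + 2)) (f := f)).trans (by rw [hC2, mul_assoc _ ((2 * k0) ^ 2)]; gcongr)
  have e3 : energy _ ≤ C3 * X := (energy_sum_ft_sprod_frac_le hs hlam hG hg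
    (Finset.Ico 2 (M + 2)) (f := f)).trans (by gcongr)
  have e4 : energy ⇑(ft (∑ j ∈ Finset.Ico 2 (M + 2),
      sprod (pp lam j f) (frac s lam j (ww lam j g)))) ≤ C4 * X := by
    rw [energy_ft]
    exact le_of_eq_of_le (congrArg energy (funext fun x => by simp))
      (h4 hlam hA hG hf hg (Finset.Ico 2 (M + 2)))
  have hm1 : ∀ u v : 𝓢(V, ℂ), Measurable fun ξ => wt s (ft u) ξ - ft v ξ := fun u v =>
    (measurable_wt _ _).sub (measurable_coe _)
  refine (energy_sub_le ?_).trans ?_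
  · exact (Finset.measurable_fun_sum _ fun k _ => hm1 _ _).add
      (Finset.measurable_fun_sum _ fun k _ => measurable_wt _ _)
  calc _ ≤ 2 * (2 * (C1 * X + C2 * X) + 2 * (C3 * X + C4 * X)) := by
        gcongr
        · refine (energy_add_le (Finset.measurable_fun_sum _ fun k _ => hm1 _ _)).trans ?_
          gcongr
        · refine (energy_add_le (Finset.measurable_fun_sum _ fun k _ => measurable_coe _)).trans ?_
          gcongr
    _ = _ := by ring

end Assembly

section Limit

variable {V : Type*} [NormedAddCommGroup V] [InnerProductSpace ℝ V] [FiniteDimensional ℝ V]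
  [MeasurableSpace V] [BorelSpace V]

omit [InnerProductSpace ℝ V] [FiniteDimensional ℝ V] [MeasurableSpace V] [BorelSpace V] in
lemma norm_wt {t : ℝ} (u : V → ℂ) (ξ : V) : ‖wt t u ξ‖ = ‖ξ‖ ^ t * ‖u ξ‖ := by
  rw [wt, norm_mul, Complex.norm_real, Real.norm_of_nonneg (by positivity)]

lemma integrable_wt {t : ℝ} (ht : 0 ≤ t) (f : 𝓢(V, ℂ)) : Integrable (wt t f) := by
  refine ((f.integrable.norm).add (f.integrable_pow_mul volume ⌈t⌉₊)).mono'
    (measurable_wt t f).aestronglyMeasurable (Eventually.of_forall fun ξ => ?_)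
  rw [norm_wt, Pi.add_apply]
  have h := norm_nonneg (f ξ)
  rcases le_total ‖ξ‖ 1 with h1 | h1
  · have := Real.rpow_le_one (norm_nonneg ξ) h1 ht
    have : 0 ≤ ‖ξ‖ ^ ⌈t⌉₊ * ‖f ξ‖ := by positivity
    nlinarith
  · have := Real.rpow_le_rpow_of_exponent_le h1 (Nat.le_ceil t)
    rw [Real.rpow_natCast] at this
    nlinarith

/-- Frequency truncations converging to the identity. -/
noncomputable def trunc (a b n : ℕ) (f : 𝓢(V, ℂ)) : 𝓢(V, ℂ) :=
  ∑ j ∈ Finset.Ico a (2 * n + b), pp ((1 / 2) ^ n) j f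

lemma ft_trunc {a b : ℕ} (hab : a ≤ b) (n : ℕ) (f : 𝓢(V, ℂ)) (ξ : V) :
    ft (trunc a b n f) ξ = ((bump ((sc ((1 / 2) ^ n) (2 * n + b))⁻¹ • ξ) -
      bump ((sc ((1 / 2) ^ n) a)⁻¹ • ξ) : ℝ) : ℂ) * ft f ξ := by
  rw [trunc, sum_pp _ (by omega), map_sub, _root_.sub_apply, ss, ss, ft_dil_apply, ft_dil_apply,
    phi_apply, phi_apply]
  push_cast
  ring

lemma norm_ft_trunc_le {a b : ℕ} (hab : a ≤ b) (n : ℕ) (f : 𝓢(V, ℂ)) (ξ : V) :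
    ‖ft (trunc a b n f) ξ‖ ≤ ‖ft f ξ‖ := by
  rw [ft_trunc hab, norm_mul, Complex.norm_real]
  refine mul_le_of_le_one_left (norm_nonneg _) ?_
  rw [Real.norm_eq_abs, abs_le]
  constructor
  · linarith [bump_nonneg ((sc ((1 / 2) ^ n) (2 * n + b))⁻¹ • ξ),
      bump_le_one ((sc ((1 / 2) ^ n) a)⁻¹ • ξ)]
  · linarith [bump_nonneg ((sc ((1 / 2) ^ n) a)⁻¹ • ξ),
      bump_le_one ((sc ((1 / 2) ^ n) (2 * n + b))⁻¹ • ξ)]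

lemma tendsto_ft_trunc {a b : ℕ} (hab : a ≤ b) (f : 𝓢(V, ℂ)) {ξ : V} (hξ : ξ ≠ 0) :
    Tendsto (fun n => ft (trunc a b n f) ξ) atTop (𝓝 (ft f ξ)) := by
  have h1 : Tendsto (fun n : ℕ => (2 : ℝ) ^ n) atTop atTop :=
    tendsto_pow_atTop_atTop_of_one_lt one_lt_two
  have h2 : Tendsto (fun n : ℕ => 2 * (2 ^ a * (1 / 2 : ℝ) ^ n)) atTop (𝓝 0) := by
    simpa using ((tendsto_pow_atTop_nhds_zero_of_lt_one (r := (1 / 2 : ℝ)) (by norm_num)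
      (by norm_num)).const_mul (2 ^ a)).const_mul 2
  refine tendsto_nhds_of_eventually_eq ?_
  filter_upwards [h1.eventually_ge_atTop ‖ξ‖, h2.eventually_lt_const (norm_pos_iff.2 hξ)]
    with n hn hn'
  have hp : (0 : ℝ) < (1 / 2) ^ n := by positivity
  have hc : (2 : ℝ) ^ n ≤ sc ((1 / 2) ^ n) (2 * n + b) := by
    have : sc ((1 / 2) ^ n) (2 * n + b) = 2 ^ b * 2 ^ n := by
      rw [sc, pow_add, pow_mul', sq, one_div, inv_pow]
      field_simp
    rw [this]
    exact le_mul_of_one_le_left (by positivity) (one_le_pow₀ one_le_two)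
  rw [ft_trunc hab, bump_eq_one, bump_eq_zero]
  · simp
  · rw [norm_inv_smul (sc_pos hp _), le_div_iff₀ (sc_pos hp _)]
    exact hn'.le
  · rw [norm_inv_smul (sc_pos hp _), div_le_one (sc_pos hp _)]
    exact hn.trans hc

lemma ft_fracSum (s : ℝ) {lam : ℝ} (hlam : 0 < lam) (M : ℕ) (g : 𝓢(V, ℂ)) (ξ : V) :
    ft (fracSum s lam M g) ξ = wt s (ft (highSum lam M g)) ξ := by
  rw [fracSum, highSum, wt_ft_sum, map_sum, _root_.sum_apply]
  refine Finset.sum_congr rfl fun k _ => ft_frac hlam (fun ξ h => ft_pp_eq_zero hlam ?_) ξ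
  have := sc_pos hlam k
  rcases h with h | h
  · left; linarith
  · right; linarith

/-- The Fourier transform of the commutator `Λ^s (f g) - f Λ^s g`. -/
noncomputable def ftComm (s : ℝ) (f g : 𝓢(V, ℂ)) (ξ : V) : ℂ :=
  wt s (ft (sprod f g)) ξ - ∫ η, ft f η * wt s (ft g) (ξ - η)

omit [FiniteDimensional ℝ V] [MeasurableSpace V] [BorelSpace V] in
lemma exists_norm_le (f : 𝓢(V, ℂ)) : ∃ B, ∀ x, ‖f x‖ ≤ B :=
  ⟨_, f.toBoundedContinuousFunction.norm_coe_le_norm⟩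

lemma tendsto_integral_conv [Nontrivial V] {u v : V → ℂ} {un vn : ℕ → V → ℂ} {B : ℝ}
    (hun : ∀ n, Measurable (un n)) (hvn : ∀ n, Measurable (vn n))
    (hub : ∀ n x, ‖un n x‖ ≤ B) (hvb : ∀ n x, ‖vn n x‖ ≤ ‖v x‖) (hv : Integrable v)
    (hul : ∀ x ≠ 0, Tendsto (fun n => un n x) atTop (𝓝 (u x)))
    (hvl : ∀ x ≠ 0, Tendsto (fun n => vn n x) atTop (𝓝 (v x))) (ξ : V) :
    Tendsto (fun n => ∫ η, un n η * vn n (ξ - η)) atTop (𝓝 (∫ η, u η * v (ξ - η))) := by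
  refine tendsto_integral_of_dominated_convergence (fun η => B * ‖v (ξ - η)‖) (fun n => ?_)
    ((hv.comp_sub_left ξ).norm.const_mul B) (fun n => Eventually.of_forall fun η => ?_) ?_
  · exact ((hun n).mul ((hvn n).comp (measurable_const.sub measurable_id))).aestronglyMeasurable
  · rw [norm_mul]
    exact mul_le_mul (hub n η) (hvb n _) (norm_nonneg _) ((norm_nonneg _).trans (hub n η))
  · filter_upwards [compl_mem_ae_iff.2 (measure_singleton (μ := (volume : Measure V)) 0),
      compl_mem_ae_iff.2 (measure_singleton (μ := (volume : Measure V)) ξ)] with η h0 h1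
    exact (hul η h0).mul (hvl _ (sub_ne_zero.2 fun h => h1 h.symm))

lemma energy_le_of_tendsto {un : ℕ → V → ℂ} {u : V → ℂ} (hun : ∀ n, Measurable (un n))
    (hl : ∀ x, Tendsto (fun n => un n x) atTop (𝓝 (u x))) {B : ℝ≥0∞}
    (hB : ∀ n, energy (un n) ≤ B) : energy u ≤ B := by
  have h : energy u = ∫⁻ x, liminf (fun n => ‖un n x‖ₑ ^ 2) atTop := by
    refine lintegral_congr fun x => Eq.symm ?_
    exact (((ENNReal.continuous_pow 2).tendsto _).comp (hl x).enorm).liminf_eq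
  rw [h]
  refine (lintegral_liminf_le fun n => (hun n).enorm.pow_const 2).trans ?_
  exact liminf_le_of_le (by isBoundedDefault) fun b hb => by
    obtain ⟨n, hn⟩ := hb.exists
    exact hn.trans (hB n)

lemma energy_ftComm_le [Nontrivial V] {s : ℝ} (hs : 1 ≤ s) :
    ∃ C : ℝ≥0∞, C ≠ ∞ ∧ ∀ {f g : 𝓢(V, ℂ)} {A G : ℝ≥0∞} (_ : A ≠ ∞) (_ : G ≠ ∞) (_ : Lip A f)
      (_ : ∀ x, ‖g x‖ₑ ≤ G),
      energy (ftComm s f g) ≤ C * (A ^ 2 * sob (s - 1) g + G ^ 2 * sob s f) := by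
  obtain ⟨C, hC, h⟩ := energy_truncated_commutator_le (V := V) hs
  refine ⟨C, hC, fun {f g A G} hA hG hf hg => ?_⟩
  have hs0 : 0 ≤ s := by linarith
  have hlam : ∀ n : ℕ, (0 : ℝ) < (1 / 2) ^ n := fun n => by positivity
  have hlow : ∀ n, lowSum ((1 / 2) ^ n) (2 * n) f = trunc 2 2 n f := fun n => rfl
  have hhigh : ∀ n, highSum ((1 / 2) ^ n) (2 * n) g = trunc 0 5 n g := fun n => by
    rw [highSum, trunc, Finset.range_eq_Ico]
  obtain ⟨B, hB⟩ := exists_norm_le (ft f)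
  refine energy_le_of_tendsto (un := fun n ξ =>
      wt s (ft (sprod (lowSum ((1 / 2) ^ n) (2 * n) f) (highSum ((1 / 2) ^ n) (2 * n) g))) ξ -
        ft (sprod (lowSum ((1 / 2) ^ n) (2 * n) f) (fracSum s ((1 / 2) ^ n) (2 * n) g)) ξ)
    (fun n => (measurable_wt _ _).sub (measurable_coe _)) (fun ξ => ?_)
    (fun n => h (hlam n) hA hG hf hg (2 * n))
  refine Tendsto.congr (f₁ := fun n => ((‖ξ‖ ^ s : ℝ) : ℂ) *
      (∫ η, ft (trunc 2 2 n f) η * ft (trunc 0 5 n g) (ξ - η)) -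
      ∫ η, ft (trunc 2 2 n f) η * wt s (ft (trunc 0 5 n g)) (ξ - η)) (fun n => ?_) ?_
  · simp_rw [ft_sprod_apply, ft_fracSum s (hlam _), hlow, hhigh]
    rw [wt, ft_sprod_apply]
  rw [ftComm, wt, ft_sprod_apply]
  refine Tendsto.sub (Tendsto.const_mul _ ?_) ?_
  · exact tendsto_integral_conv (fun n => measurable_coe _) (fun n => measurable_coe _)
      (fun n x => (norm_ft_trunc_le le_rfl n f x).trans (hB x))
      (fun n x => norm_ft_trunc_le (by norm_num) n g x) (ft g).integrable
      (fun x hx => tendsto_ft_trunc le_rfl f hx)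
      (fun x hx => tendsto_ft_trunc (by norm_num) g hx) ξ
  · refine tendsto_integral_conv (v := wt s (ft g)) (fun n => measurable_coe _)
      (fun n => measurable_wt s _)
      (fun n x => (norm_ft_trunc_le le_rfl n f x).trans (hB x))
      (fun n x => ?_) (integrable_wt hs0 _)
      (fun x hx => tendsto_ft_trunc le_rfl f hx)
      (fun x hx => (tendsto_ft_trunc (by norm_num) g hx).const_mul _) ξ
    rw [norm_wt, norm_wt]
    gcongr
    exact norm_ft_trunc_le (by norm_num) n g x

end Limit

section Plancherel

variable {V : Type*} [NormedAddCommGroup V] [InnerProductSpace ℝ V] [FiniteDimensional ℝ V]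
  [MeasurableSpace V] [BorelSpace V]

lemma continuous_fourierInv {u : V → ℂ} (hu : Integrable u) : Continuous (𝓕⁻ u) := by
  have : 𝓕⁻ u = fun x => 𝓕 u (-x) := funext fun x => Real.fourierInv_eq_fourier_neg u x
  rw [this]
  exact (VectorFourier.fourierIntegral_continuous Real.continuous_fourierChar
    (by exact continuous_inner) hu).comp continuous_neg

lemma integral_schwartz_mul_fourierInv {u : V → ℂ} (hu : Integrable u) (φ : 𝓢(V, ℂ)) :
    ∫ x, φ x * 𝓕⁻ u x = ∫ x, 𝓕⁻ (φ : V → ℂ) x * u x := by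
  have key := VectorFourier.integral_fourierIntegral_smul_eq_flip (μ := volume) (ν := volume)
    (e := Real.fourierChar) (L := -innerₗ V) (f := φ) (g := u) Real.continuous_fourierChar
    (by simp; fun_prop) φ.integrable hu
  refine Eq.trans (integral_congr_ae (Eventually.of_forall fun x => ?_)) (key.symm.trans
    (integral_congr_ae (Eventually.of_forall fun x => ?_)))
  · simp [VectorFourier.fourierIntegral, Real.fourierInv_eq, real_inner_comm]
  · simp [VectorFourier.fourierIntegral, Real.fourierInv_eq, real_inner_comm]

lemma eLpNorm_fourierInv {u : V → ℂ} (hu : Integrable u) (hu2 : MemLp u 2) :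
    eLpNorm (𝓕⁻ u) 2 volume = eLpNorm u 2 volume := by
  set U : Lp ℂ 2 (volume : Measure V) := hu2.toLp u with hU
  have hae : (𝓕⁻ U : Lp ℂ 2 (volume : Measure V)) =ᵐ[volume] 𝓕⁻ u := by
    refine ae_eq_of_integral_contDiff_smul_eq ((Lp.memLp _).locallyIntegrable (by norm_num))
      (continuous_fourierInv hu).locallyIntegrable fun g hg hgc => ?_
    have hg₁ : HasCompactSupport (Complex.ofRealCLM ∘ g) := hgc.comp_left rfl
    have hg₂ : ContDiff ℝ (⊤ : ℕ∞) (Complex.ofRealCLM ∘ g) := by fun_prop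
    set φ : 𝓢(V, ℂ) := hg₁.toSchwartzMap hg₂ with hφ
    have h1 := congrArg (fun T => T φ) (Lp.fourierInv_toTemperedDistribution_eq U)
    simp only [Lp.toTemperedDistribution_apply] at h1
    rw [TemperedDistribution.fourierInv_apply, Lp.toTemperedDistribution_apply] at h1
    calc _ = ∫ x, φ x • (𝓕⁻ U : Lp ℂ 2 (volume : Measure V)) x := by
          refine integral_congr_ae (Eventually.of_forall fun x => ?_)
          simp [hφ]
      _ = ∫ x, 𝓕⁻ (φ : V → ℂ) x * u x := by
          rw [← h1]
          refine integral_congr_ae ?_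
          filter_upwards [hu2.coeFn_toLp] with x hx
          rw [hU, hx, smul_eq_mul, fourierInv_coe]
      _ = ∫ x, φ x * 𝓕⁻ u x := (integral_schwartz_mul_fourierInv hu φ).symm
      _ = _ := by
          refine integral_congr_ae (Eventually.of_forall fun x => ?_)
          simp [hφ]
  have hn : ‖(𝓕⁻ U : Lp ℂ 2 (volume : Measure V))‖ = ‖U‖ := by
    have h : 𝓕 (𝓕⁻ U : Lp ℂ 2 (volume : Measure V)) = U := FourierTransform.fourier_fourierInv_eq U
    rw [← Lp.norm_fourier_eq (𝓕⁻ U : Lp ℂ 2 (volume : Measure V)), h]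
  rw [← eLpNorm_congr_ae hae, ← eLpNorm_congr_ae hu2.coeFn_toLp]
  rwa [Lp.norm_def, Lp.norm_def, ENNReal.toReal_eq_toReal_iff' (Lp.eLpNorm_ne_top _)
    (Lp.eLpNorm_ne_top _)] at hn

end Plancherel

section Inverse

variable {V : Type*} [NormedAddCommGroup V] [InnerProductSpace ℝ V] [FiniteDimensional ℝ V]
  [MeasurableSpace V] [BorelSpace V]

lemma energy_ne_top_of_bound {u v : V → ℂ} {B : ℝ≥0∞} (hB : B ≠ ∞) (hv : Integrable v)
    (h : ∀ x, ‖u x‖ₑ ^ 2 ≤ B * ‖v x‖ₑ) : energy u ≠ ∞ := by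
  refine ne_top_of_le_ne_top ?_ (lintegral_mono h)
  rw [lintegral_const_mul' _ _ hB]
  exact ENNReal.mul_ne_top hB hv.2.ne

lemma memLp_two_of_energy {u : V → ℂ} (hu : AEStronglyMeasurable u volume) (h : energy u ≠ ∞) :
    MemLp u 2 := by
  refine ⟨hu, lt_top_iff_ne_top.2 fun h' => h ?_⟩
  rw [energy_eq_eLpNorm_sq, h']
  simp

lemma sob_ne_top {t : ℝ} (ht : 0 ≤ t) (f : 𝓢(V, ℂ)) : sob t f ≠ ∞ := by
  obtain ⟨B, hB⟩ := exists_norm_le (ft f)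
  refine energy_ne_top_of_bound (B := ENNReal.ofReal B) ENNReal.ofReal_ne_top
    (integrable_wt (add_nonneg ht ht) (ft f)) fun x => ?_
  have h : ‖ft f x‖ₑ ≤ ENNReal.ofReal B := by
    rw [← ofReal_norm]
    exact ENNReal.ofReal_le_ofReal (hB x)
  rw [enorm_wt ht, enorm_wt (add_nonneg ht ht), ENNReal.rpow_add_of_nonneg _ _ ht ht]
  calc _ = ‖ft f x‖ₑ * (‖x‖ₑ ^ t * ‖x‖ₑ ^ t * ‖ft f x‖ₑ) := by ring
    _ ≤ _ := by gcongr

lemma energy_fourierInv {u : V → ℂ} (hu : Integrable u) (h : energy u ≠ ∞) :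
    energy (𝓕⁻ u) = energy u := by
  rw [energy_eq_eLpNorm_sq, energy_eq_eLpNorm_sq,
    eLpNorm_fourierInv hu (memLp_two_of_energy hu.aestronglyMeasurable h)]

lemma fourierInv_sub {u v : V → ℂ} (hu : Integrable u) (hv : Integrable v) (x : V) :
    𝓕⁻ (fun ξ => u ξ - v ξ) x = 𝓕⁻ u x - 𝓕⁻ v x := by
  have h : ∀ {w : V → ℂ}, Integrable w →
      Integrable fun ξ => Real.fourierChar (inner ℝ ξ x) • w ξ := fun {w} hw => by
    have := (Real.fourierIntegral_convergent_iff (μ := volume) (f := w) (-x)).2 hw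
    simpa using this
  simp_rw [Real.fourierInv_eq, smul_sub]
  exact integral_sub (h hu) (h hv)

lemma integrable_conv {u v : V → ℂ} (hu : Integrable u) (hv : Integrable v) :
    Integrable fun ξ => ∫ η, u η * v (ξ - η) :=
  hu.integrable_convolution (ContinuousLinearMap.mul ℂ ℂ) hv

lemma fourierInv_conv {u v : V → ℂ} (hu : Integrable u) (hv : Integrable v) (x : V) :
    𝓕⁻ (fun ξ => ∫ η, u η * v (ξ - η)) x = 𝓕⁻ u x * 𝓕⁻ v x := by
  rw [Real.fourierInv_eq_fourier_neg, Real.fourierInv_eq_fourier_neg,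
    Real.fourierInv_eq_fourier_neg]
  exact Real.fourier_mul_convolution_eq hu hv (-x)

lemma integrable_ftComm {s : ℝ} (hs : 0 ≤ s) (f g : 𝓢(V, ℂ)) : Integrable (ftComm s f g) :=
  (integrable_wt hs _).sub (integrable_conv (ft f).integrable (integrable_wt hs _))

lemma fourierInv_ftComm {s : ℝ} (hs : 0 ≤ s) (f g : 𝓢(V, ℂ)) (x : V) :
    𝓕⁻ (ftComm s f g) x =
      𝓕⁻ (wt s (ft (sprod f g))) x - f x * 𝓕⁻ (wt s (ft g)) x := by
  have h := fourierInv_sub (integrable_wt hs (ft (sprod f g)))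
    (integrable_conv (ft f).integrable (integrable_wt hs (ft g))) x
  rw [fourierInv_conv (ft f).integrable (integrable_wt hs (ft g)), ← ft_symm_coe,
    ft.symm_apply_apply] at h
  exact h

/-- A real valued Schwartz function, viewed as a complex valued one. -/
noncomputable def cplx (f : 𝓢(V, ℝ)) : 𝓢(V, ℂ) := f.postcompCLM Complex.ofRealCLM

omit [FiniteDimensional ℝ V] [MeasurableSpace V] [BorelSpace V] in
lemma cplx_apply (f : 𝓢(V, ℝ)) (x : V) : cplx f x = (f x : ℂ) := rfl

lemma conj_ft_cplx (f : 𝓢(V, ℝ)) (ξ : V) :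
    (starRingEnd ℂ) (ft (cplx f) ξ) = ft (cplx f) (-ξ) := by
  rw [ft_coe, Real.fourier_eq, Real.fourier_eq, ← integral_conj]
  refine integral_congr_ae (Eventually.of_forall fun x => ?_)
  simp only [cplx_apply, Circle.smul_def, smul_eq_mul, map_mul, Complex.conj_ofReal,
    ← Circle.coe_inv_eq_conj, ← AddChar.map_neg_eq_inv, inner_neg_right, neg_neg]

lemma conj_fourierInv_wt (t : ℝ) (f : 𝓢(V, ℝ)) (x : V) :
    (starRingEnd ℂ) (𝓕⁻ (wt t (ft (cplx f))) x) = 𝓕⁻ (wt t (ft (cplx f))) x := by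
  rw [Real.fourierInv_eq, ← integral_conj, ← integral_neg_eq_self]
  refine integral_congr_ae (Eventually.of_forall fun ξ => ?_)
  simp only [wt, Circle.smul_def, smul_eq_mul, map_mul, Complex.conj_ofReal, conj_ft_cplx,
    ← Circle.coe_inv_eq_conj, ← AddChar.map_neg_eq_inv, inner_neg_left, neg_neg, norm_neg]

lemma eLpNorm_re_fourierInv_wt {t : ℝ} (ht : 0 ≤ t) (f : 𝓢(V, ℝ)) :
    eLpNorm (fun x => (𝓕⁻ (wt t (ft (cplx f))) x).re) 2 volume ^ 2 = sob t (cplx f) := by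
  have h : eLpNorm (fun x => (𝓕⁻ (wt t (ft (cplx f))) x).re) 2 volume =
      eLpNorm (𝓕⁻ (wt t (ft (cplx f)))) 2 volume := by
    refine eLpNorm_congr_norm_ae (Eventually.of_forall fun x => ?_)
    rw [← Complex.norm_real, Complex.conj_eq_iff_re.1 (conj_fourierInv_wt t f x)]
  rw [h, ← energy_eq_eLpNorm_sq, energy_fourierInv (integrable_wt ht _) (sob_ne_top ht _)]
  rfl

lemma enorm_le_eLpNorm_top {F : Type*} [NormedAddCommGroup F] {f : V → F} (hf : Continuous f)
    (x : V) : ‖f x‖ₑ ≤ eLpNorm f ⊤ volume := by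
  have hd : Dense {y | ‖f y‖ₑ ≤ eLpNorm f ⊤ volume} := by
    refine Measure.dense_of_ae (μ := volume) ?_
    rw [eLpNorm_exponent_top]
    exact ae_le_eLpNormEssSup
  have hc : IsClosed {y | ‖f y‖ₑ ≤ eLpNorm f ⊤ volume} :=
    isClosed_le hf.enorm continuous_const
  have := hd x
  rwa [hc.closure_eq] at this

lemma eLpNorm_fderiv_ne_top (f : 𝓢(V, ℝ)) : eLpNorm (fun x => ‖fderiv ℝ f x‖) ⊤ volume ≠ ∞ := by
  rw [eLpNorm_norm]
  exact ((fderivCLM ℝ V ℝ f).eLpNorm_lt_top ⊤ volume).ne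

lemma lip_cplx (f : 𝓢(V, ℝ)) : Lip (eLpNorm (fun x => ‖fderiv ℝ f x‖) ⊤ volume) (cplx f) := by
  have hc : Continuous (fderiv ℝ f) := (f.smooth 1).continuous_fderiv one_ne_zero
  have h : LipschitzWith (eLpNorm (fun x => ‖fderiv ℝ f x‖) ⊤ volume).toNNReal f := by
    refine lipschitzWith_of_nnnorm_fderiv_le f.differentiable fun x => ?_
    rw [← ENNReal.coe_le_coe, ENNReal.coe_toNNReal (eLpNorm_fderiv_ne_top f), eLpNorm_norm]
    exact enorm_le_eLpNorm_top hc x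
  intro x y
  have := h.edist_le_mul x y
  rw [ENNReal.coe_toNNReal (eLpNorm_fderiv_ne_top f), edist_eq_enorm_sub,
    edist_eq_enorm_sub] at this
  rw [cplx_apply, cplx_apply, ← Complex.ofReal_sub, ← ofReal_norm, Complex.norm_real, ofReal_norm]
  exact this

omit [FiniteDimensional ℝ V] [MeasurableSpace V] [BorelSpace V] in
lemma sprod_cplx_coe (f g : 𝓢(V, ℝ)) :
    (sprod (cplx f) (cplx g) : V → ℂ) = fun x => ((f x * g x : ℝ) : ℂ) := by
  funext x
  simp [cplx_apply]

/-- The commutator estimate in terms of real parts of inverse Fourier transforms. -/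
lemma eLpNorm_commutator_le [Nontrivial V] {s : ℝ} (hs : 1 ≤ s) :
    ∃ C : ℝ, 0 < C ∧ ∀ f g : 𝓢(V, ℝ),
      eLpNorm (fun x => (𝓕⁻ (wt s (ft (sprod (cplx f) (cplx g)))) x).re -
          f x * (𝓕⁻ (wt s (ft (cplx g))) x).re) 2 volume ≤
        ENNReal.ofReal C * (eLpNorm (fun x => ‖fderiv ℝ f x‖) ⊤ volume *
            eLpNorm (fun x => (𝓕⁻ (wt (s - 1) (ft (cplx g))) x).re) 2 volume +
          eLpNorm g ⊤ volume * eLpNorm (fun x => (𝓕⁻ (wt s (ft (cplx f))) x).re) 2 volume) := by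
  obtain ⟨C, hC, h⟩ := energy_ftComm_le (V := V) hs
  have hs0 : 0 ≤ s := by linarith
  refine ⟨C.toReal + 1, by positivity, fun f g => ?_⟩
  have hC1 : C ≤ ENNReal.ofReal (C.toReal + 1) ^ 2 := by
    have h1 : C ≤ ENNReal.ofReal (C.toReal + 1) := by
      conv_lhs => rw [← ENNReal.ofReal_toReal hC]
      exact ENNReal.ofReal_le_ofReal (by linarith)
    refine h1.trans (le_self_pow₀ ?_ two_ne_zero)
    rw [ENNReal.one_le_ofReal]
    linarith [C.toReal_nonneg]
  have hA := eLpNorm_fderiv_ne_top f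
  have hG := (g.eLpNorm_lt_top ⊤ volume).ne
  have key := h hA hG (lip_cplx f) (g := cplx g) fun x => by
    rw [cplx_apply, ← ofReal_norm, Complex.norm_real, ofReal_norm]
    exact enorm_le_eLpNorm_top g.continuous x
  have hfin : energy (ftComm s (cplx f) (cplx g)) ≠ ∞ := by
    refine ne_top_of_le_ne_top ?_ key
    have h1 := sob_ne_top (sub_nonneg.2 hs) (cplx g)
    have h2 := sob_ne_top hs0 (cplx f)
    finiteness
  rw [← energy_fourierInv (integrable_ftComm hs0 _ _) hfin, energy_eq_eLpNorm_sq,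
    ← eLpNorm_re_fourierInv_wt (sub_nonneg.2 hs), ← eLpNorm_re_fourierInv_wt hs0] at key
  refine (eLpNorm_mono (g := 𝓕⁻ (ftComm s (cplx f) (cplx g))) fun x => ?_).trans ?_
  · rw [fourierInv_ftComm hs0, cplx_apply]
    refine le_of_eq_of_le ?_ (Complex.abs_re_le_norm _)
    rw [Complex.sub_re, Complex.re_ofReal_mul, Real.norm_eq_abs]
  · refine (ENNReal.pow_le_pow_left_iff two_ne_zero).1 (key.trans ?_)
    rw [mul_pow, add_sq, mul_pow, mul_pow]
    gcongr
    exact le_self_add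

end Inverse

end KatoPonce

/-- **commutator estimate.** Let `N ≥ 1` and `s ≥ 1`.  Then there is `C > 0`
such that for all `f, g ∈ S(ℝ^N)`:
`‖Λ^s(fg) − f Λ^s g‖_{L²} ≤ C(‖∇f‖_{L^∞} ‖Λ^{s−1} g‖_{L²} + ‖g‖_{L^∞} ‖Λ^s f‖_{L²})`. -/
theorem statement6 (N : ℕ) (hN : 1 ≤ N) (s : ℝ) (hs : 1 ≤ s) :
    ∃ C : ℝ, 0 < C ∧ ∀ f g : SchwartzMap (EuclideanSpace ℝ (Fin N)) ℝ,
      eLpNorm (fun x => LamF N s (fun y => f y * g y) x - f x * LamF N s (⇑g) x) 2 volume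
        ≤ ENNReal.ofReal C *
          (eLpNorm (fun x => ‖fderiv ℝ (⇑f) x‖) ⊤ volume
              * eLpNorm (LamF N (s - 1) (⇑g)) 2 volume
            + eLpNorm (⇑g) ⊤ volume * eLpNorm (LamF N s (⇑f)) 2 volume) := by
  have : Nonempty (Fin N) := ⟨⟨0, hN⟩⟩
  obtain ⟨C, hC, h⟩ := KatoPonce.eLpNorm_commutator_le (V := EuclideanSpace ℝ (Fin N)) hs
  refine ⟨C, hC, fun f g => ?_⟩
  have hLam : ∀ (t : ℝ) (f : SchwartzMap (EuclideanSpace ℝ (Fin N)) ℝ),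
      LamF N t f = fun x => (𝓕⁻ (KatoPonce.wt t (KatoPonce.ft (KatoPonce.cplx f))) x).re :=
    fun _ _ => rfl
  have hprod : LamF N s (fun y => f y * g y) = fun x => (𝓕⁻ (KatoPonce.wt s
      (KatoPonce.ft (KatoPonce.sprod (KatoPonce.cplx f) (KatoPonce.cplx g)))) x).re := by
    rw [KatoPonce.ft_coe, KatoPonce.sprod_cplx_coe]
    rfl
  rw [hprod, hLam, hLam, hLam]
  exact h f g
end

section
/- Let N ≥ 2 and let Θ : ℝ^N → [0,∞) be measurable with M := ∫_{ℝ^N} Θ(x) dx ∈ (0,∞) and w := ∫_{ℝ^N} |x|² Θ(x) dx < ∞. Set J := ∫_{ℝ^N}∫_{ℝ^N} Θ(x) Θ(y) |x−y|^{−(N−1)} dx dy ∈ [0,∞]. Then M^{N+3} ≤ 2^{N−1} w^{N−1} J²; equivalently, if w > 0, then J ≥ 2^{−(N−1)/2} M^{(N+3)/2} w^{−(N−1)/2}. -/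
open MeasureTheory Filter Topology
open scoped ENNReal

section SecondMoment

variable {E : Type*} [NormedAddCommGroup E] [InnerProductSpace ℝ E]
  [MeasurableSpace E] [BorelSpace E] [SecondCountableTopology E] {μ : Measure E} {Θ : E → ℝ}

/-- A nonnegative density with finite mass and finite second moment has a first moment. -/
lemma integrable_smul_id_of_second_moment (hmeas : Measurable Θ) (hnonneg : ∀ x, 0 ≤ Θ x)
    (hint : Integrable Θ μ) (hw : Integrable (fun x => ‖x‖ ^ 2 * Θ x) μ) :
    Integrable (fun x => Θ x • x) μ := by
  refine (hint.add hw).mono' (hmeas.smul measurable_id).aestronglyMeasurable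
    (Eventually.of_forall fun x => ?_)
  simp only [norm_smul, Real.norm_of_nonneg (hnonneg x), Pi.add_apply]
  nlinarith [hnonneg x, mul_nonneg (hnonneg x) (sq_nonneg (‖x‖ - 1)),
    mul_nonneg (hnonneg x) (norm_nonneg x)]

/-- The pair second moment `∬ Θ(x) Θ(y) |x - y|²` is at most twice the mass times the second
moment. -/
lemma lintegral_prod_mul_norm_sub_sq_le [CompleteSpace E] [SFinite μ] (hmeas : Measurable Θ)
    (hnonneg : ∀ x, 0 ≤ Θ x) (hint : Integrable Θ μ)
    (hw : Integrable (fun x => ‖x‖ ^ 2 * Θ x) μ) :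
    ∫⁻ p : E × E, ENNReal.ofReal (Θ p.1 * Θ p.2 * ‖p.1 - p.2‖ ^ 2) ∂(μ.prod μ)
      ≤ ENNReal.ofReal (2 * (∫ x, Θ x ∂μ) * ∫ x, ‖x‖ ^ 2 * Θ x ∂μ) := by
  have hf := integrable_smul_id_of_second_moment hmeas hnonneg hint hw
  have h1 : Integrable (fun p : E × E => (‖p.1‖ ^ 2 * Θ p.1) * Θ p.2) (μ.prod μ) :=
    hw.mul_prod hint
  have h2 : Integrable (fun p : E × E => Θ p.1 * (‖p.2‖ ^ 2 * Θ p.2)) (μ.prod μ) :=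
    hint.mul_prod hw
  have h3 : Integrable (fun p : E × E => inner ℝ (Θ p.1 • p.1) (Θ p.2 • p.2)) (μ.prod μ) := by
    refine (hf.norm.mul_prod hf.norm).mono' ?_ (Eventually.of_forall fun p => norm_inner_le_norm _ _)
    exact (((hmeas.comp measurable_fst).smul measurable_fst).inner
      ((hmeas.comp measurable_snd).smul measurable_snd)).aestronglyMeasurable
  have h12 : Integrable (fun p : E × E =>
      (‖p.1‖ ^ 2 * Θ p.1) * Θ p.2 + Θ p.1 * (‖p.2‖ ^ 2 * Θ p.2)) (μ.prod μ) := h1.add h2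
  have hexp : (fun p : E × E => Θ p.1 * Θ p.2 * ‖p.1 - p.2‖ ^ 2) = fun p =>
      (‖p.1‖ ^ 2 * Θ p.1) * Θ p.2 + Θ p.1 * (‖p.2‖ ^ 2 * Θ p.2)
        - 2 * inner ℝ (Θ p.1 • p.1) (Θ p.2 • p.2) := by
    funext p
    rw [norm_sub_sq_real, real_inner_smul_left, real_inner_smul_right]
    ring
  have hcross : ∫ p : E × E, inner ℝ (Θ p.1 • p.1) (Θ p.2 • p.2) ∂(μ.prod μ)
      = ‖∫ x, Θ x • x ∂μ‖ ^ 2 := by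
    rw [integral_prod _ h3, ← real_inner_self_eq_norm_sq]
    simp_rw [integral_inner hf]
    simp_rw [real_inner_comm (∫ x, Θ x • x ∂μ)]
    exact integral_inner hf _
  have hint' : Integrable (fun p : E × E => Θ p.1 * Θ p.2 * ‖p.1 - p.2‖ ^ 2) (μ.prod μ) := by
    rw [hexp]
    exact h12.sub (h3.const_mul 2)
  rw [← ofReal_integral_eq_lintegral_ofReal hint' (Eventually.of_forall fun p =>
    mul_nonneg (mul_nonneg (hnonneg _) (hnonneg _)) (sq_nonneg _))]
  refine ENNReal.ofReal_le_ofReal ?_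
  rw [hexp, integral_sub h12 (h3.const_mul 2), integral_add h1 h2, integral_const_mul,
    hcross, integral_prod_mul (fun x => ‖x‖ ^ 2 * Θ x) Θ,
    integral_prod_mul Θ (fun x => ‖x‖ ^ 2 * Θ x)]
  nlinarith [sq_nonneg ‖∫ x, Θ x • x ∂μ‖]

end SecondMoment

/-- In a product of a measure without atoms with itself, almost every pair is off-diagonal. -/
lemma ae_prod_fst_ne_snd {α : Type*} [MeasurableSpace α] [MeasurableEq α]
    (μ : Measure α) [SFinite μ] [NullSingletonClass μ] : ∀ᵐ p ∂(μ.prod μ), p.1 ≠ p.2 := by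
  have h : MeasurableSet {p : α × α | p.1 = p.2} := measurableSet_diagonal
  rw [ae_iff]
  simp only [ne_eq, not_not]
  rw [Measure.measure_prod_null h]
  refine Eventually.of_forall fun x => ?_
  have : Prod.mk x ⁻¹' {p : α × α | p.1 = p.2} = {x} := by
    ext y
    simp [eq_comm]
  simp [this]

/-- The pointwise splitting `t = (t d²)^a (t d^{-(n-1)})^b` with `a = (n-1)/(n+1)`,
`b = 2/(n+1)`. -/
lemma ofReal_eq_rpow_mul_rpow {n t d : ℝ} (hn : 1 ≤ n) (ht : 0 ≤ t) (hd : 0 < d) :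
    ENNReal.ofReal t = ENNReal.ofReal (t * d ^ 2) ^ ((n - 1) / (n + 1)) *
      ENNReal.ofReal (t / d ^ (n - 1)) ^ (2 / (n + 1)) := by
  have ha : 0 ≤ (n - 1) / (n + 1) := div_nonneg (by linarith) (by linarith)
  have hb : 0 ≤ 2 / (n + 1) := div_nonneg (by norm_num) (by linarith)
  have hab : (n - 1) / (n + 1) + 2 / (n + 1) = 1 := by
    field_simp
    ring
  have hdp : 0 < d ^ (n - 1) := Real.rpow_pos_of_pos hd _
  rw [ENNReal.ofReal_rpow_of_nonneg (by positivity) ha,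
    ENNReal.ofReal_rpow_of_nonneg (by positivity) hb, ← ENNReal.ofReal_mul (by positivity),
    Real.mul_rpow ht (by positivity), Real.div_rpow ht hdp.le, ← Real.rpow_mul hd.le,
    ← Real.rpow_natCast, ← Real.rpow_mul hd.le]
  have he : ((2 : ℕ) : ℝ) * ((n - 1) / (n + 1)) = (n - 1) * (2 / (n + 1)) := by
    push_cast
    ring
  have ht1 : t ^ ((n - 1) / (n + 1)) * t ^ (2 / (n + 1)) = t := by
    rw [← Real.rpow_add_of_nonneg ht ha hb, hab, Real.rpow_one]
  have hne : d ^ ((n - 1) * (2 / (n + 1))) ≠ 0 := (Real.rpow_pos_of_pos hd _).ne'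
  rw [he]
  congr 1
  field_simp
  exact ht1.symm

/-- Let `N ≥ 2` and `Θ : ℝ^N → [0,∞)` measurable with
`M = ∫ Θ ∈ (0,∞)` and `w = ∫ |x|² Θ(x) dx < ∞`.  With
`J = ∬ Θ(x) Θ(y) |x−y|^{−(N−1)} dx dy ∈ [0,∞]`, one has `M^{N+3} ≤ 2^{N−1} w^{N−1} J²`. -/
theorem statement8 (N : ℕ) (hN : 2 ≤ N) (Θ : EuclideanSpace ℝ (Fin N) → ℝ)
    (hmeas : Measurable Θ) (hnonneg : ∀ x, 0 ≤ Θ x)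
    (hint : Integrable Θ volume) (hM : 0 < ∫ x, Θ x)
    (hw : Integrable (fun x : EuclideanSpace ℝ (Fin N) => ‖x‖ ^ 2 * Θ x) volume) :
    ENNReal.ofReal ((∫ x, Θ x) ^ (N + 3))
      ≤ ENNReal.ofReal (2 ^ (N - 1) *
            (∫ x : EuclideanSpace ℝ (Fin N), ‖x‖ ^ 2 * Θ x) ^ (N - 1)) *
        (∫⁻ pr : EuclideanSpace ℝ (Fin N) × EuclideanSpace ℝ (Fin N),
          ENNReal.ofReal (Θ pr.1 * Θ pr.2 / ‖pr.1 - pr.2‖ ^ ((N : ℝ) - 1))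
            ∂(volume.prod volume)) ^ 2 := by
  have : Nontrivial (EuclideanSpace ℝ (Fin N)) := by
    have : Nonempty (Fin N) := ⟨⟨0, by omega⟩⟩
    infer_instance
  have hA := lintegral_prod_mul_norm_sub_sq_le hmeas hnonneg hint hw
  set M := ∫ x, Θ x
  set w := ∫ x : EuclideanSpace ℝ (Fin N), ‖x‖ ^ 2 * Θ x
  set J := ∫⁻ pr : EuclideanSpace ℝ (Fin N) × EuclideanSpace ℝ (Fin N),
    ENNReal.ofReal (Θ pr.1 * Θ pr.2 / ‖pr.1 - pr.2‖ ^ ((N : ℝ) - 1)) ∂(volume.prod volume)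
  have hw0 : 0 ≤ w := integral_nonneg fun x => mul_nonneg (sq_nonneg _) (hnonneg x)
  have hN1 : (1 : ℝ) ≤ N := by exact_mod_cast (by omega : 1 ≤ N)
  have hNpos : (0 : ℝ) < N + 1 := by linarith
  have hMM : ENNReal.ofReal (M ^ 2) = ∫⁻ p : EuclideanSpace ℝ (Fin N) × EuclideanSpace ℝ (Fin N),
      ENNReal.ofReal (Θ p.1 * Θ p.2) ∂(volume.prod volume) := by
    rw [← ofReal_integral_eq_lintegral_ofReal (hint.mul_prod hint)
      (Eventually.of_forall fun p => mul_nonneg (hnonneg _) (hnonneg _)),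
      integral_prod_mul Θ Θ, sq]
  have hholder : ENNReal.ofReal (M ^ 2) ≤
      ENNReal.ofReal (2 * M * w) ^ (((N : ℝ) - 1) / (N + 1)) * J ^ (2 / ((N : ℝ) + 1)) := by
    rw [hMM]
    calc _ = ∫⁻ p : EuclideanSpace ℝ (Fin N) × EuclideanSpace ℝ (Fin N),
          ENNReal.ofReal (Θ p.1 * Θ p.2 * ‖p.1 - p.2‖ ^ 2) ^ (((N : ℝ) - 1) / (N + 1)) *
          ENNReal.ofReal (Θ p.1 * Θ p.2 / ‖p.1 - p.2‖ ^ ((N : ℝ) - 1)) ^ (2 / ((N : ℝ) + 1))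
            ∂(volume.prod volume) := by
          refine lintegral_congr_ae ?_
          filter_upwards [ae_prod_fst_ne_snd (volume : Measure (EuclideanSpace ℝ (Fin N)))]
            with p hp
          exact ofReal_eq_rpow_mul_rpow hN1 (mul_nonneg (hnonneg _) (hnonneg _))
            (norm_pos_iff.2 (sub_ne_zero.2 hp))
      _ ≤ _ := ENNReal.lintegral_mul_norm_pow_le (by fun_prop) (by fun_prop)
          (div_nonneg (by linarith) hNpos.le) (div_nonneg (by norm_num) hNpos.le)
          (by field_simp; ring)
      _ ≤ _ := by
          gcongr
  have hpow := ENNReal.rpow_le_rpow hholder hNpos.le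
  rw [ENNReal.mul_rpow_of_nonneg _ _ hNpos.le, ← ENNReal.rpow_mul, ← ENNReal.rpow_mul,
    div_mul_cancel₀ _ hNpos.ne', div_mul_cancel₀ _ hNpos.ne',
    show (N : ℝ) + 1 = ((N + 1 : ℕ) : ℝ) by push_cast; ring,
    show (N : ℝ) - 1 = ((N - 1 : ℕ) : ℝ) by rw [Nat.cast_sub (by omega)]; simp,
    show (2 : ℝ) = ((2 : ℕ) : ℝ) by norm_num, ENNReal.rpow_natCast, ENNReal.rpow_natCast,
    ENNReal.rpow_natCast, ← ENNReal.ofReal_pow (by positivity),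
    ← ENNReal.ofReal_pow (by positivity)] at hpow
  have hMpos : 0 < M ^ (N - 1) := by positivity
  refine (ENNReal.mul_le_mul_iff_right (ENNReal.ofReal_pos.2 hMpos).ne'
    ENNReal.ofReal_ne_top).1 ?_
  rw [← mul_assoc, ← ENNReal.ofReal_mul hMpos.le, ← ENNReal.ofReal_mul hMpos.le]
  convert hpow using 3
  · rw [← pow_add, ← pow_mul]
    congr 1
    omega
  · push_cast
    ring
end
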